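/- arXiv:2211.11846 — 9 statements merged into one kernel-verified Lean document; each statement's English description precedes it below -/
import Mathlib

section
/- There exists a universal constant c > 0 such that for every integer d ≥ 1, every real w > 0, and all points p, q ∈ ℝ^d with w/(2√d) ≤ ‖p − q‖₂ ≤ w, one has vol(B₂(p,w) ∩ B₂(q,w)) / vol(B₂(p,w) ∪ B₂(q,w)) ≥ c·(1/√d)·(w/‖p − q‖₂)·(1 − (‖p − q‖₂/(2w))²)^{d/2}. -/
open MeasureTheory

/-- The volume of the unit ball of `EuclideanSpace ℝ (Fin n)`. -/
noncomputable def unitBallVolume (n : ℕ) : ℝ :=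
  Real.sqrt Real.pi ^ n / Real.Gamma ((n : ℝ) / 2 + 1)

lemma unitBallVolume_pos (n : ℕ) : 0 < unitBallVolume n :=
  div_pos (pow_pos (Real.sqrt_pos.2 Real.pi_pos) n) (Real.Gamma_pos_of_pos (by positivity))

lemma volume_euclidean_closedBall {n : ℕ} (x : EuclideanSpace ℝ (Fin n)) {r : ℝ} (hr : 0 ≤ r) :
    volume (Metric.closedBall x r) = ENNReal.ofReal (r ^ n * unitBallVolume n) := by
  rcases n with _ | n
  · have h : Metric.closedBall x r = Set.univ := by
      ext y
      simp [Subsingleton.elim y x, hr]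
    have h' := (PiLp.volume_preserving_ofLp (Fin 0)).measure_preimage
      (s := Set.univ) MeasurableSet.univ.nullMeasurableSet
    rw [h, ← Set.preimage_univ, h']
    simp [unitBallVolume, volume_pi]
  · rw [EuclideanSpace.volume_closedBall, Fintype.card_fin, ENNReal.ofReal_mul (by positivity),
      ENNReal.ofReal_pow hr, unitBallVolume]

lemma sqrt_mul_Gamma_add_half_le {x : ℝ} (hx : 0 < x) :
    Real.sqrt x * Real.Gamma (x + 1 / 2) ≤ Real.Gamma (x + 1) := by
  have h := Real.Gamma_mul_add_mul_le_rpow_Gamma_mul_rpow_Gamma (s := x) (t := x + 1)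
    (a := 1 / 2) (b := 1 / 2) hx (by linarith) (by norm_num) (by norm_num) (by norm_num)
  rw [show 1 / 2 * x + 1 / 2 * (x + 1) = x + 1 / 2 by ring, ← Real.sqrt_eq_rpow,
    ← Real.sqrt_eq_rpow] at h
  have hG := Real.Gamma_pos_of_pos hx
  rw [Real.Gamma_add_one hx.ne', Real.sqrt_mul hx.le] at *
  have h1 := Real.mul_self_sqrt hx.le
  have h2 := Real.mul_self_sqrt hG.le
  calc √x * Real.Gamma (x + 1 / 2)
      ≤ √x * (√(Real.Gamma x) * (√x * √(Real.Gamma x))) := by gcongr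
    _ = (√x * √x) * (√(Real.Gamma x) * √(Real.Gamma x)) := by ring
    _ = x * Real.Gamma x := by rw [h1, h2]

lemma sqrt_mul_unitBallVolume_succ_le (n : ℕ) :
    Real.sqrt ((n + 1 : ℕ) : ℝ) * unitBallVolume (n + 1) ≤ 3 * unitBallVolume n := by
  have hx : (0 : ℝ) < ((n + 1 : ℕ) : ℝ) / 2 := by positivity
  have h := sqrt_mul_Gamma_add_half_le hx
  have e : ((n + 1 : ℕ) : ℝ) / 2 + 1 / 2 = (n : ℝ) / 2 + 1 := by push_cast; ring
  rw [e] at h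
  have hG : 0 < Real.Gamma ((n : ℝ) / 2 + 1) := Real.Gamma_pos_of_pos (by positivity)
  have hG' : 0 < Real.Gamma (((n + 1 : ℕ) : ℝ) / 2 + 1) := Real.Gamma_pos_of_pos (by positivity)
  have hs : Real.sqrt ((n + 1 : ℕ) : ℝ) * √Real.pi ≤ 3 * √(((n + 1 : ℕ) : ℝ) / 2) := by
    rw [← Real.sqrt_mul (by positivity), show (3 : ℝ) = √9 by
      rw [show (9 : ℝ) = 3 ^ 2 by norm_num, Real.sqrt_sq (by norm_num)],
      ← Real.sqrt_mul (by norm_num)]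
    apply Real.sqrt_le_sqrt
    nlinarith [Real.pi_lt_d2]
  unfold unitBallVolume
  rw [← mul_div_assoc, ← mul_div_assoc, div_le_div_iff₀ hG' hG, pow_succ]
  calc _ = (√Real.pi ^ n * Real.Gamma ((n : ℝ) / 2 + 1)) *
        (Real.sqrt ((n + 1 : ℕ) : ℝ) * √Real.pi) := by ring
    _ ≤ (√Real.pi ^ n * Real.Gamma ((n : ℝ) / 2 + 1)) * (3 * √(((n + 1 : ℕ) : ℝ) / 2)) := by
        gcongr
    _ = 3 * √Real.pi ^ n * (√(((n + 1 : ℕ) : ℝ) / 2) * Real.Gamma ((n : ℝ) / 2 + 1)) := by ring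
    _ ≤ _ := by gcongr

/-- Splitting a Euclidean space along a unit vector `u` preserves volume. -/
lemma exists_measurePreserving_split {n : ℕ} {u : EuclideanSpace ℝ (Fin (n + 1))}
    (hu : ‖u‖ = 1) :
    ∃ Φ : EuclideanSpace ℝ (Fin (n + 1)) → ℝ × EuclideanSpace ℝ (Fin n),
      MeasurePreserving Φ ∧
        ∀ x (a : ℝ), ‖x - a • u‖ ^ 2 = ((Φ x).1 - a) ^ 2 + ‖(Φ x).2‖ ^ 2 := by
  have hv : Orthonormal ℝ
      (({0} : Set (Fin (n + 1))).domRestrict (fun _ => u)) := by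
    refine ⟨fun _ => hu, fun i j hij => (hij (Subsingleton.elim i j)).elim⟩
  obtain ⟨b, hb⟩ := hv.exists_orthonormalBasis_extension_of_card_eq (by simp)
  have hb0 : b 0 = u := hb 0 rfl
  refine ⟨fun x => (b.repr x 0, WithLp.toLp 2 fun i : Fin n => b.repr x i.succ), ?_, ?_⟩
  · exact ((MeasurePreserving.id volume).prod (PiLp.volume_preserving_toLp (Fin n))).comp
      ((volume_preserving_piFinSuccAbove (fun _ : Fin (n + 1) => ℝ) 0).comp
        ((PiLp.volume_preserving_ofLp (Fin (n + 1))).comp b.measurePreserving_repr))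
  · intro x a
    rw [← b.repr.norm_map (x - a • u), EuclideanSpace.real_norm_sq_eq,
      EuclideanSpace.real_norm_sq_eq, Fin.sum_univ_succ, ← hb0]
    simp [Fin.succ_ne_zero]

/-- The intersection of two balls of radius `w` at distance `2 * h` contains a cylinder of
half-height `δ` and radius `r` as soon as `(h + δ) ^ 2 + r ^ 2 ≤ w ^ 2`. -/
lemma cylinder_volume_le_volume_inter {n : ℕ} {p q : EuclideanSpace ℝ (Fin (n + 1))}
    {w h δ r : ℝ} (hw : 0 ≤ w) (hh : 0 < h) (hδ : 0 ≤ δ) (hr : 0 ≤ r) (hpq : dist p q = 2 * h)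
    (hle : (h + δ) ^ 2 + r ^ 2 ≤ w ^ 2) :
    2 * δ * (r ^ n * unitBallVolume n) ≤
      (volume (Metric.closedBall p w ∩ Metric.closedBall q w)).toReal := by
  set m : EuclideanSpace ℝ (Fin (n + 1)) := (1 / 2 : ℝ) • (p + q) with hm
  set u : EuclideanSpace ℝ (Fin (n + 1)) := (1 / (2 * h)) • (p - q) with hu
  have hpu : p = m + h • u := by
    have : h * (1 / (2 * h)) = 1 / 2 := by field_simp
    rw [hu, hm, smul_smul, this]; module
  have hqu : q = m + (-h) • u := by
    have : -h * (1 / (2 * h)) = -(1 / 2) := by field_simp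
    rw [hu, hm, smul_smul, this]; module
  have hun : ‖u‖ = 1 := by
    rw [hu, norm_smul, ← dist_eq_norm, hpq, Real.norm_of_nonneg (by positivity)]
    field_simp
  obtain ⟨Φ, hΦ, hnorm⟩ := exists_measurePreserving_split hun
  have hmp := hΦ.comp (measurePreserving_sub_right volume m)
  have hvol := hmp.measure_preimage (s := Set.Icc (-δ) δ ×ˢ Metric.closedBall 0 r)
    (measurableSet_Icc.prod Metric.isClosed_closedBall.measurableSet).nullMeasurableSet
  rw [Measure.volume_eq_prod, Measure.prod_prod, Real.volume_Icc,
    volume_euclidean_closedBall _ hr, ← ENNReal.ofReal_mul (by linarith)] at hvol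
  have hV := unitBallVolume_pos n
  rw [show 2 * δ * (r ^ n * unitBallVolume n) = (δ - -δ) * (r ^ n * unitBallVolume n) by ring,
    ← ENNReal.toReal_ofReal (r := (δ - -δ) * (r ^ n * unitBallVolume n))
      (mul_nonneg (by linarith) (by positivity)), ← hvol]
  refine ENNReal.toReal_mono
    ((measure_mono Set.inter_subset_left).trans_lt measure_closedBall_lt_top).ne
    (measure_mono ?_)
  rintro x ⟨⟨hx1, hx2⟩, hx3⟩
  simp only [Function.comp_apply, mem_closedBall_zero_iff] at hx1 hx2 hx3
  have hx3' : ‖(Φ (x - m)).2‖ ^ 2 ≤ r ^ 2 := by gcongr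
  constructor
  · rw [Metric.mem_closedBall, dist_eq_norm, hpu, ← sub_sub]
    refine le_of_sq_le_sq ?_ hw
    rw [hnorm]
    nlinarith
  · rw [Metric.mem_closedBall, dist_eq_norm, hqu, ← sub_sub]
    refine le_of_sq_le_sq ?_ hw
    rw [hnorm]
    nlinarith

lemma volume_union_closedBall_bounds {n : ℕ} (p q : EuclideanSpace ℝ (Fin n)) {w : ℝ}
    (hw : 0 < w) :
    0 < (volume (Metric.closedBall p w ∪ Metric.closedBall q w)).toReal ∧
      (volume (Metric.closedBall p w ∪ Metric.closedBall q w)).toReal ≤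
        2 * (w ^ n * unitBallVolume n) := by
  have hV : 0 < w ^ n * unitBallVolume n := mul_pos (pow_pos hw n) (unitBallVolume_pos n)
  have hle : volume (Metric.closedBall p w ∪ Metric.closedBall q w) ≤
      ENNReal.ofReal (2 * (w ^ n * unitBallVolume n)) := by
    refine (measure_union_le _ _).trans_eq ?_
    rw [volume_euclidean_closedBall p hw.le, volume_euclidean_closedBall q hw.le,
      ← ENNReal.ofReal_add hV.le hV.le, two_mul]
  refine ⟨ENNReal.toReal_pos ?_ (hle.trans_lt ENNReal.ofReal_lt_top).ne,
    ENNReal.toReal_le_of_le_ofReal (by positivity) hle⟩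
  exact ((Metric.measure_closedBall_pos volume p hw).trans_le
    (measure_mono Set.subset_union_left)).ne'

lemma three_quarters_le_one_sub_pow (n : ℕ) :
    (3 / 4 : ℝ) ≤ (1 - 1 / (4 * ((n + 1 : ℕ) : ℝ))) ^ n := by
  have hD : (1 : ℝ) ≤ ((n + 1 : ℕ) : ℝ) := by exact_mod_cast Nat.succ_pos n
  have hx : 1 / (4 * ((n + 1 : ℕ) : ℝ)) ≤ 1 := by
    rw [div_le_one (by positivity)]; linarith
  have h := one_add_mul_le_pow (a := -(1 / (4 * ((n + 1 : ℕ) : ℝ)))) (by linarith) n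
  rw [← sub_eq_add_neg] at h
  refine le_trans ?_ h
  have : (n : ℝ) * (1 / (4 * ((n + 1 : ℕ) : ℝ))) ≤ 1 / 4 := by
    rw [mul_one_div, div_le_div_iff₀ (by positivity) (by norm_num)]
    push_cast; linarith
  linarith

/-- The cylinder used to bound the intersection of the balls fits inside it. -/
lemma cylinder_radius_bound {D w h : ℝ} (hD : 1 ≤ D) (hw : 0 < w) (hh : 0 < h)
    (hlow : w ^ 2 ≤ 16 * D * h ^ 2) (hup : 2 * h ≤ w) :
    (h + w ^ 2 / (16 * D * h)) ^ 2 + (Real.sqrt (w ^ 2 - h ^ 2) * (1 - 1 / (4 * D))) ^ 2 ≤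
      w ^ 2 := by
  have hD0 : 0 < D := by linarith
  set x := w ^ 2 / D with hx
  have hx0 : 0 ≤ x := by positivity
  have hδ : (h + w ^ 2 / (16 * D * h)) ^ 2 ≤ h ^ 2 + 3 / 16 * x := by
    have e : (h + w ^ 2 / (16 * D * h)) ^ 2 =
        h ^ 2 + x / 8 + x / 16 * (w ^ 2 / (16 * D * h ^ 2)) := by
      rw [hx]; field_simp; ring
    have : w ^ 2 / (16 * D * h ^ 2) ≤ 1 := by
      rw [div_le_one (by positivity)]; exact hlow
    nlinarith
  have hs : 3 / 4 * w ^ 2 ≤ w ^ 2 - h ^ 2 := by nlinarith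
  have hy : 1 / (4 * D) ≤ 1 := by
    rw [div_le_one (by positivity)]; linarith
  have hy0 : 0 ≤ 1 / (4 * D) := by positivity
  have hr : (Real.sqrt (w ^ 2 - h ^ 2) * (1 - 1 / (4 * D))) ^ 2 ≤
      (w ^ 2 - h ^ 2) * (1 - 1 / (4 * D)) := by
    rw [mul_pow, Real.sq_sqrt (by nlinarith)]
    apply mul_le_mul_of_nonneg_left _ (by nlinarith)
    nlinarith
  have hz : 3 / 16 * x ≤ (w ^ 2 - h ^ 2) * (1 / (4 * D)) := by
    calc 3 / 16 * x = 3 / 4 * w ^ 2 * (1 / (4 * D)) := by rw [hx]; field_simp; ring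
      _ ≤ _ := by gcongr
  linarith

/-- **Volume ratio of intersecting Euclidean balls.**  There is a universal constant `c > 0`
such that for every `d ≥ 1`, `w > 0`, and points `p, q ∈ ℝ^d` with
`w/(2√d) ≤ ‖p - q‖₂ ≤ w`, one has
`vol(B(p,w) ∩ B(q,w)) / vol(B(p,w) ∪ B(q,w)) ≥
  c · (1/√d) · (w/‖p-q‖₂) · (1 - (‖p-q‖₂/(2w))²)^{d/2}`. -/
theorem euclidean_ball_intersection_volume_ratio :
    ∃ c : ℝ, 0 < c ∧
      ∀ d : ℕ, 1 ≤ d → ∀ w : ℝ, 0 < w →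
        ∀ p q : EuclideanSpace ℝ (Fin d),
          w / (2 * Real.sqrt d) ≤ dist p q → dist p q ≤ w →
          c * (1 / Real.sqrt d) * (w / dist p q) *
              (1 - (dist p q / (2 * w)) ^ 2) ^ ((d : ℝ) / 2) ≤
            (volume (Metric.closedBall p w ∩ Metric.closedBall q w)).toReal /
              (volume (Metric.closedBall p w ∪ Metric.closedBall q w)).toReal := by
  refine ⟨1 / 32, by norm_num, ?_⟩
  intro d hd w hw p q hlow hup
  obtain ⟨n, rfl⟩ : ∃ n, d = n + 1 := ⟨d - 1, by omega⟩
  set D : ℝ := ((n + 1 : ℕ) : ℝ) with hDdef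
  have hD : 1 ≤ D := by rw [hDdef]; exact_mod_cast hd
  have hD0 : 0 < D := by linarith
  have hS : 0 < Real.sqrt D := Real.sqrt_pos.2 hD0
  have hSS : Real.sqrt D * Real.sqrt D = D := Real.mul_self_sqrt hD0.le
  obtain ⟨h, hpq⟩ : ∃ h, dist p q = 2 * h := ⟨dist p q / 2, by ring⟩
  rw [hpq] at hlow hup ⊢
  have hh : 0 < h := by
    have : 0 < w / (2 * Real.sqrt D) := by positivity
    linarith
  have hlow' : w ^ 2 ≤ 16 * D * h ^ 2 := by
    rw [div_le_iff₀ (by positivity)] at hlow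
    calc w ^ 2 ≤ (2 * h * (2 * Real.sqrt D)) ^ 2 := by gcongr
      _ = 16 * (Real.sqrt D * Real.sqrt D) * h ^ 2 := by ring
      _ = _ := by rw [hSS]
  set s := Real.sqrt (w ^ 2 - h ^ 2) with hs
  have hs0 : 0 ≤ s := Real.sqrt_nonneg _
  have hsw : s ≤ w := by
    rw [hs, Real.sqrt_le_left hw.le]; nlinarith
  have hy : 0 ≤ 1 - 1 / (4 * D) := by
    rw [sub_nonneg, div_le_one (by positivity)]; linarith
  have hI := cylinder_volume_le_volume_inter hw.le hh
    (by positivity : 0 ≤ w ^ 2 / (16 * D * h)) (mul_nonneg hs0 hy) hpq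
    (cylinder_radius_bound hD hw hh hlow' hup)
  obtain ⟨hU0, hU⟩ := volume_union_closedBall_bounds p q hw
  have hV := unitBallVolume_pos n
  have hV' := unitBallVolume_pos (n + 1)
  have hpow : (1 - (2 * h / (2 * w)) ^ 2) ^ (D / 2) = (s / w) ^ (n + 1) := by
    have e : 1 - (2 * h / (2 * w)) ^ 2 = (w ^ 2 - h ^ 2) / w ^ 2 := by field_simp
    rw [e, Real.rpow_div_two_eq_sqrt _ (div_nonneg (by nlinarith) (by positivity)),
      Real.sqrt_div (by nlinarith), Real.sqrt_sq hw.le, hDdef, Real.rpow_natCast]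
  rw [hpow, le_div_iff₀ hU0]
  calc 1 / 32 * (1 / √D) * (w / (2 * h)) * (s / w) ^ (n + 1) *
        (volume (Metric.closedBall p w ∪ Metric.closedBall q w)).toReal
      ≤ 1 / 32 * (1 / √D) * (w / (2 * h)) * (s / w) ^ (n + 1) *
        (2 * (w ^ (n + 1) * unitBallVolume (n + 1))) := by gcongr
    _ = 1 / 32 * (w / h) * s ^ n * s / (√D * √D) * (√D * unitBallVolume (n + 1)) := by
        rw [div_pow, pow_succ s]; field_simp
    _ ≤ 1 / 32 * (w / h) * s ^ n * w / (√D * √D) * (3 * unitBallVolume n) := by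
        refine mul_le_mul ?_ (sqrt_mul_unitBallVolume_succ_le n) (by positivity) (by positivity)
        gcongr
    _ = 2 * (w ^ 2 / (16 * D * h)) * ((s ^ n * (3 / 4)) * unitBallVolume n) := by
        rw [hSS]; field_simp; ring
    _ ≤ 2 * (w ^ 2 / (16 * D * h)) * ((s * (1 - 1 / (4 * D))) ^ n * unitBallVolume n) := by
        rw [mul_pow]
        gcongr
        exact three_quarters_le_one_sub_pow n
    _ ≤ _ := hI
end

section
/- There exist universal constants c, C > 0 such that for every real p ∈ [1,2], every integer d ≥ 1, every real w > 0, and all points x, y ∈ ℝ^d with d^{−1/p}·w ≤ ‖x − y‖_p ≤ w/3, one has vol(B_p(x,w) ∩ B_p(y,w)) / vol(B_p(x,w) ∪ B_p(y,w)) ≥ c·exp(−C·d·(‖x − y‖_p/w)^p). -/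
open MeasureTheory

/-- The `ℓ_p` distance on `ℝ^d`: `‖x - y‖_p = (∑ i, |x i - y i| ^ p) ^ (1/p)`. -/
noncomputable def lpDist (p : ℝ) {d : ℕ} (x y : Fin d → ℝ) : ℝ :=
  (∑ i, |x i - y i| ^ p) ^ (1 / p)

/-- The closed `ℓ_p` ball of radius `r` around `x` in `ℝ^d`. -/
def lpBall (p : ℝ) {d : ℕ} (x : Fin d → ℝ) (r : ℝ) : Set (Fin d → ℝ) :=
  {y | lpDist p x y ≤ r}

theorem abs_add_rpow_add_abs_sub_rpow_le {p : ℝ} (hp1 : 1 ≤ p) (hp2 : p ≤ 2) (a b : ℝ) :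
    |a + b| ^ p + |a - b| ^ p ≤ 2 * (|a| ^ p + |b| ^ p) := by
  have hsq (t : ℝ) : |t| ^ p = (t ^ 2) ^ (p / 2) := by
    rw [← sq_abs, ← Real.rpow_natCast, ← Real.rpow_mul (abs_nonneg t)]
    congr 1
    push_cast
    ring
  rw [hsq, hsq, hsq, hsq]
  have hconc := (Real.concaveOn_rpow (p := p / 2) (by linarith) (by linarith)).2
    (Set.mem_Ici.2 (sq_nonneg (a + b))) (Set.mem_Ici.2 (sq_nonneg (a - b)))
    (by norm_num : (0 : ℝ) ≤ 1 / 2) (by norm_num : (0 : ℝ) ≤ 1 / 2) (by norm_num)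
  have hsub := NNReal.rpow_add_le_add_rpow ⟨a ^ 2, sq_nonneg a⟩ ⟨b ^ 2, sq_nonneg b⟩
    (p := p / 2) (by linarith) (by linarith)
  have hsub' : (a ^ 2 + b ^ 2) ^ (p / 2) ≤ (a ^ 2) ^ (p / 2) + (b ^ 2) ^ (p / 2) := by
    exact_mod_cast hsub
  simp only [smul_eq_mul] at hconc
  rw [show 1 / 2 * (a + b) ^ 2 + 1 / 2 * (a - b) ^ 2 = a ^ 2 + b ^ 2 by ring] at hconc
  linarith

theorem rpow_sub_rpow_le {p x y : ℝ} (hp2 : p ≤ 2) (hx : 0 < x) (hy : 0 ≤ y)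
    (hp : 0 < p) (hyx : y ≤ x) :
    x ^ p - y ^ p ≤ x ^ (p - 2) * (x ^ 2 - y ^ 2) := by
  have h2 : x ^ (p - 2) * x ^ 2 = x ^ p := by
    rw [← Real.rpow_natCast, ← Real.rpow_add hx]
    congr 1
    push_cast
    ring
  suffices x ^ (p - 2) * y ^ 2 ≤ y ^ p by rw [mul_sub, h2]; linarith
  rcases hy.eq_or_lt with rfl | hy
  · simp [Real.zero_rpow hp.ne']
  have h3 : y ^ (p - 2) * y ^ 2 = y ^ p := by
    rw [← Real.rpow_natCast, ← Real.rpow_add hy]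
    congr 1
    push_cast
    ring
  rw [← h3]
  gcongr 1
  exact Real.rpow_le_rpow_of_nonpos hy hyx (by linarith)

theorem sq_abs_add_rpow_sub_abs_sub_rpow_le_of_pos {p : ℝ} (hp1 : 1 ≤ p) (hp2 : p ≤ 2) {a b : ℝ}
    (ha : 0 < a) (hb : 0 < b) :
    ((|a + b| ^ p - |a - b| ^ p) / 2) ^ 2 ≤ 4 * (a ^ p * b ^ p) := by
  have hab : 0 < a + b := by positivity
  have hle : |a - b| ≤ a + b := abs_le.2 ⟨by linarith, by linarith⟩
  have h1 := rpow_sub_rpow_le hp2 hab (abs_nonneg (a - b)) (by linarith) hle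
  rw [sq_abs, show (a + b) ^ 2 - (a - b) ^ 2 = 4 * (a * b) by ring] at h1
  have h0 : |a - b| ^ p ≤ (a + b) ^ p := by gcongr
  rw [abs_of_pos hab]
  have ha2 : a ^ (p - 2) * a ^ 2 = a ^ p := by
    rw [← Real.rpow_natCast, ← Real.rpow_add ha]
    congr 1
    push_cast
    ring
  have hb2 : b ^ (p - 2) * b ^ 2 = b ^ p := by
    rw [← Real.rpow_natCast, ← Real.rpow_add hb]
    congr 1
    push_cast
    ring
  have hxa : (a + b) ^ (p - 2) ≤ a ^ (p - 2) :=
    Real.rpow_le_rpow_of_nonpos ha (by linarith) (by linarith)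
  have hxb : (a + b) ^ (p - 2) ≤ b ^ (p - 2) :=
    Real.rpow_le_rpow_of_nonpos hb (by linarith) (by linarith)
  calc (((a + b) ^ p - |a - b| ^ p) / 2) ^ 2
      ≤ ((a + b) ^ (p - 2) * (4 * (a * b)) / 2) ^ 2 := by
        gcongr
    _ = 4 * (((a + b) ^ (p - 2) * (a + b) ^ (p - 2)) * (a ^ 2 * b ^ 2)) := by ring
    _ ≤ 4 * ((a ^ (p - 2) * b ^ (p - 2)) * (a ^ 2 * b ^ 2)) := by gcongr
    _ = 4 * (a ^ p * b ^ p) := by rw [← ha2, ← hb2]; ring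

theorem sq_abs_add_rpow_sub_abs_sub_rpow_le {p : ℝ} (hp1 : 1 ≤ p) (hp2 : p ≤ 2) (a b : ℝ) :
    ((|a + b| ^ p - |a - b| ^ p) / 2) ^ 2 ≤ 4 * (|a| ^ p * |b| ^ p) := by
  have hp : p ≠ 0 := by linarith
  rcases eq_or_ne a 0 with rfl | ha
  · simp [Real.zero_rpow hp]
  rcases eq_or_ne b 0 with rfl | hb
  · simp [Real.zero_rpow hp]
  have key := sq_abs_add_rpow_sub_abs_sub_rpow_le_of_pos hp1 hp2 (abs_pos.2 ha) (abs_pos.2 hb)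
  refine le_trans (le_of_eq ?_) key
  rcases abs_choice a with h | h <;> rcases abs_choice b with h' | h' <;> rw [h, h']
  · rw [← sub_eq_add_neg, sub_neg_eq_add]; ring
  · rw [show -a + b = -(a - b) by ring, show -a - b = -(a + b) by ring, abs_neg, abs_neg]; ring
  · rw [show -a + -b = -(a + b) by ring, show -a - -b = -(a - b) by ring, abs_neg, abs_neg]

theorem setIntegral_comp_of_involutive {α : Type*} [MeasurableSpace α] {μ : Measure α} {T : α → α}
    (hT : MeasurePreserving T μ μ) (hinv : Function.Involutive T) {s : Set α}
    (hs : T ⁻¹' s = s) (f : α → ℝ) : ∫ x in s, f (T x) ∂μ = ∫ x in s, f x ∂μ := by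
  have hemb : MeasurableEmbedding T :=
    (MeasurableEquiv.mk hinv.toPerm hT.measurable hT.measurable).measurableEmbedding
  simpa only [hs] using hT.setIntegral_preimage_emb hemb f s

/-- Reflection of the `i`-th coordinate. -/
def coordReflection {d : ℕ} (i : Fin d) (z : Fin d → ℝ) : Fin d → ℝ :=
  fun j => (if j = i then Neg.neg else id : ℝ → ℝ) (z j)

theorem coordReflection_self {d : ℕ} (i : Fin d) (z : Fin d → ℝ) :
    coordReflection i z i = -z i := by simp [coordReflection]

theorem coordReflection_of_ne {d : ℕ} {i j : Fin d} (h : j ≠ i) (z : Fin d → ℝ) :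
    coordReflection i z j = z j := by simp [coordReflection, h]

theorem abs_coordReflection {d : ℕ} (i j : Fin d) (z : Fin d → ℝ) :
    |coordReflection i z j| = |z j| := by
  by_cases h : j = i <;> simp [coordReflection, h]

theorem coordReflection_involutive {d : ℕ} (i : Fin d) :
    Function.Involutive (coordReflection i) := by
  intro z
  ext j
  by_cases h : j = i <;> simp [coordReflection, h]

theorem measurePreserving_coordReflection {d : ℕ} (i : Fin d) :
    MeasurePreserving (coordReflection i) := by
  refine volume_preserving_pi fun j => ?_
  by_cases h : j = i
  · simpa [h] using Measure.measurePreserving_neg (volume : Measure ℝ)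
  · simpa [h] using MeasurePreserving.id (volume : Measure ℝ)

theorem measurePreserving_comp_swap {d : ℕ} (i j : Fin d) :
    MeasurePreserving fun (z : Fin d → ℝ) k => z (Equiv.swap i j k) := by
  have h := volume_measurePreserving_piCongrLeft (fun _ : Fin d => ℝ) (Equiv.swap i j)
  have heq : (fun (z : Fin d → ℝ) k => z (Equiv.swap i j k)) =
      MeasurableEquiv.piCongrLeft (fun _ : Fin d => ℝ) (Equiv.swap i j) := by
    ext z k
    rw [MeasurableEquiv.coe_piCongrLeft, Equiv.piCongrLeft_apply_eq_cast]
    simp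
  rwa [heq]

/-- The set of points whose `p`-th power sum is at most `R`. -/
def powerBall (p : ℝ) (d : ℕ) (R : ℝ) : Set (Fin d → ℝ) := {z | ∑ i, |z i| ^ p ≤ R}

theorem continuous_abs_rpow {p : ℝ} (hp : 0 ≤ p) : Continuous fun t : ℝ => |t| ^ p :=
  continuous_abs.rpow_const fun _ => Or.inr hp

theorem isCompact_powerBall {p : ℝ} (hp : 0 < p) (d : ℕ) (R : ℝ) :
    IsCompact (powerBall p d R) := by
  rcases lt_or_ge R 0 with hR | hR
  · have : powerBall p d R = ∅ := by
      ext z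
      simp only [powerBall, Set.mem_ofPred_eq, Set.mem_empty_iff_false, iff_false, not_le]
      exact hR.trans_le (by positivity)
    simp [this]
  refine (isCompact_univ_pi fun _ : Fin d =>
    isCompact_Icc (a := -R ^ p⁻¹) (b := R ^ p⁻¹)).of_isClosed_subset ?_ ?_
  · exact isClosed_le (continuous_finsetSum _ fun i _ =>
      (continuous_abs_rpow hp.le).comp (continuous_apply i)) continuous_const
  · intro z hz i _
    rw [Set.mem_Icc, ← abs_le]
    have : |z i| ^ p ≤ R := (Finset.single_le_sum (f := fun i => |z i| ^ p)
      (fun _ _ => by positivity) (Finset.mem_univ i)).trans hz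
    exact (Real.le_rpow_inv_iff_of_pos (abs_nonneg _) hR hp).2 this

theorem integrableOn_powerBall {p : ℝ} (hp : 0 < p) {d : ℕ} (R : ℝ) {f : (Fin d → ℝ) → ℝ}
    (hf : Continuous f) : IntegrableOn f (powerBall p d R) :=
  hf.continuousOn.integrableOn_compact (isCompact_powerBall hp d R)

theorem coordReflection_preimage_powerBall (p : ℝ) {d : ℕ} (R : ℝ) (i : Fin d) :
    coordReflection i ⁻¹' powerBall p d R = powerBall p d R := by
  ext z
  simp [powerBall, abs_coordReflection]

theorem setIntegral_powerBall_abs_rpow_le {p : ℝ} (hp : 0 < p) {d : ℕ} (R : ℝ) (i : Fin d) :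
    d * ∫ z in powerBall p d R, |z i| ^ p ≤ R * volume.real (powerBall p d R) := by
  have hswap (j : Fin d) : ∫ z in powerBall p d R, |z j| ^ p = ∫ z in powerBall p d R, |z i| ^ p := by
    have := setIntegral_comp_of_involutive (measurePreserving_comp_swap i j)
      (fun z => by ext k; simp) (s := powerBall p d R)
      (by
        ext z
        simp only [powerBall, Set.mem_preimage, Set.mem_ofPred_eq]
        rw [Equiv.sum_comp (Equiv.swap i j) fun k => |z k| ^ p])
      (fun z => |z i| ^ p)
    simpa using this
  have hcont (j : Fin d) : Continuous fun z : Fin d → ℝ => |z j| ^ p :=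
    (continuous_abs_rpow hp.le).comp (continuous_apply j)
  have hsum : ∑ j, ∫ z in powerBall p d R, |z j| ^ p = d * ∫ z in powerBall p d R, |z i| ^ p := by
    simp [hswap]
  rw [← hsum, ← integral_finsetSum _ fun j _ => integrableOn_powerBall hp R (hcont j)]
  have := setIntegral_mono_on (integrableOn_powerBall hp R
    (continuous_finsetSum _ fun j _ => hcont j))
    (integrableOn_powerBall hp R (continuous_const (y := R)))
    (isCompact_powerBall hp d R).measurableSet (fun z hz => hz)
  simpa [mul_comm] using this

theorem setIntegral_powerBall_mul_eq_zero {p : ℝ} {d : ℕ} (R : ℝ) {g : Fin d → ℝ → ℝ}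
    (hg : ∀ i t, g i (-t) = -g i t) {i j : Fin d} (hij : j ≠ i) :
    ∫ z in powerBall p d R, g i (z i) * g j (z j) = 0 := by
  have h := setIntegral_comp_of_involutive (measurePreserving_coordReflection i)
    (coordReflection_involutive i) (coordReflection_preimage_powerBall p R i)
    (fun z => g i (z i) * g j (z j))
  simp only [coordReflection_self, coordReflection_of_ne hij, hg, neg_mul, integral_neg] at h
  linarith

theorem setIntegral_powerBall_sq_sum {p : ℝ} (hp : 0 < p) {d : ℕ} (R : ℝ) {g : Fin d → ℝ → ℝ}
    (hgc : ∀ i, Continuous (g i)) (hg : ∀ i t, g i (-t) = -g i t) :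
    ∫ z in powerBall p d R, (∑ i, g i (z i)) ^ 2 =
      ∑ i, ∫ z in powerBall p d R, g i (z i) ^ 2 := by
  have hc (i j : Fin d) : Continuous fun z : Fin d → ℝ => g i (z i) * g j (z j) :=
    ((hgc i).comp (continuous_apply i)).mul ((hgc j).comp (continuous_apply j))
  simp only [sq, Finset.sum_mul_sum]
  rw [integral_finsetSum _ fun i _ => integrableOn_powerBall hp R
    (continuous_finsetSum _ fun j _ => hc i j)]
  refine Finset.sum_congr rfl fun i _ => ?_
  rw [integral_finsetSum _ fun j _ => integrableOn_powerBall hp R (hc i j)]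
  exact Finset.sum_eq_single i
    (fun j _ hj => setIntegral_powerBall_mul_eq_zero R hg hj) (by simp)

/-- Half the difference of the `p`-th power sums of `z + v` and `z - v`. -/
noncomputable def halfPowerDiff (p : ℝ) {d : ℕ} (v z : Fin d → ℝ) : ℝ :=
  ∑ i, (|z i + v i| ^ p - |z i - v i| ^ p) / 2

theorem setIntegral_sq_halfPowerDiff_le {p : ℝ} (hp1 : 1 ≤ p) (hp2 : p ≤ 2) {d : ℕ} (R : ℝ)
    (v : Fin d → ℝ) :
    d * ∫ z in powerBall p d R, halfPowerDiff p v z ^ 2 ≤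
      4 * (∑ i, |v i| ^ p) * R * volume.real (powerBall p d R) := by
  have hp : 0 < p := by linarith
  have hcont (i : Fin d) : Continuous fun t : ℝ => (|t + v i| ^ p - |t - v i| ^ p) / 2 :=
    ((((continuous_abs_rpow hp.le).comp (continuous_add_const (v i)))).sub
      ((continuous_abs_rpow hp.le).comp (continuous_sub_right (v i)))).div_const 2
  have hodd (i : Fin d) (t : ℝ) :
      (|-t + v i| ^ p - |-t - v i| ^ p) / 2 = -((|t + v i| ^ p - |t - v i| ^ p) / 2) := by
    rw [show -t + v i = -(t - v i) by ring, show -t - v i = -(t + v i) by ring, abs_neg, abs_neg]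
    ring
  unfold halfPowerDiff
  rw [setIntegral_powerBall_sq_sum hp R hcont hodd, Finset.mul_sum, Finset.mul_sum,
    Finset.sum_mul, Finset.sum_mul]
  refine Finset.sum_le_sum fun i _ => ?_
  have hle : ∫ z in powerBall p d R, ((|z i + v i| ^ p - |z i - v i| ^ p) / 2) ^ 2 ≤
      ∫ z in powerBall p d R, 4 * |v i| ^ p * |z i| ^ p := by
    refine setIntegral_mono (integrableOn_powerBall hp R
      (((hcont i).comp (continuous_apply i)).pow 2)) (integrableOn_powerBall hp R
      (continuous_const.mul ((continuous_abs_rpow hp.le).comp (continuous_apply i)))) fun z => ?_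
    have := sq_abs_add_rpow_sub_abs_sub_rpow_le hp1 hp2 (z i) (v i)
    simp only
    linarith
  rw [integral_const_mul] at hle
  have h2 := setIntegral_powerBall_abs_rpow_le hp R i
  calc _ ≤ (d : ℝ) * (4 * |v i| ^ p * ∫ z in powerBall p d R, |z i| ^ p) := by gcongr
    _ = 4 * |v i| ^ p * (d * ∫ z in powerBall p d R, |z i| ^ p) := by ring
    _ ≤ 4 * |v i| ^ p * (R * volume.real (powerBall p d R)) := by gcongr
    _ = _ := by ring

theorem half_volume_powerBall_le {p : ℝ} (hp1 : 1 ≤ p) (hp2 : p ≤ 2) {d : ℕ} {R : ℝ}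
    {v : Fin d → ℝ} (hd : 0 < d) (hv : 0 < ∑ i, |v i| ^ p)
    (hR : R ≤ d * (4 * ∑ i, |v i| ^ p)) :
    volume.real (powerBall p d R) / 2 ≤
      volume.real {z ∈ powerBall p d R | |halfPowerDiff p v z| ≤ 6 * ∑ i, |v i| ^ p} := by
  have hp : 0 < p := by linarith
  set V := ∑ i, |v i| ^ p
  set B := powerBall p d R
  have hB : IsCompact B := isCompact_powerBall hp d R
  have hcont : Continuous (halfPowerDiff p v) :=
    continuous_finsetSum _ fun i _ =>
      (((continuous_abs_rpow hp.le).comp ((continuous_apply i).add continuous_const)).sub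
      ((continuous_abs_rpow hp.le).comp ((continuous_apply i).sub continuous_const))).div_const 2
  have hd' : (0 : ℝ) < d := by exact_mod_cast hd
  have hmarkov := mul_meas_ge_le_integral_of_nonneg (μ := volume.restrict B)
    (f := fun z => halfPowerDiff p v z ^ 2) (Filter.Eventually.of_forall fun z => sq_nonneg _)
    (integrableOn_powerBall hp R (hcont.pow 2)) ((6 * V) ^ 2)
  have hint : ∫ z in B, halfPowerDiff p v z ^ 2 ≤ 16 * V ^ 2 * volume.real B := by
    refine le_of_mul_le_mul_left ?_ hd'
    refine (setIntegral_sq_halfPowerDiff_le hp1 hp2 R v).trans ?_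
    calc 4 * V * R * volume.real B ≤ 4 * V * (d * (4 * V)) * volume.real B := by gcongr
      _ = _ := by ring
  have hmeas : MeasurableSet {z | (6 * V) ^ 2 ≤ halfPowerDiff p v z ^ 2} :=
    (isClosed_le continuous_const (hcont.pow 2)).measurableSet
  rw [measureReal_restrict_apply hmeas] at hmarkov
  have hbad : volume.real ({z | (6 * V) ^ 2 ≤ halfPowerDiff p v z ^ 2} ∩ B) ≤
      volume.real B / 2 := by
    refine le_of_mul_le_mul_left ?_ (show 0 < (6 * V) ^ 2 by positivity)
    refine (hmarkov.trans hint).trans ?_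
    have : 0 ≤ V ^ 2 * volume.real B := by positivity
    linarith
  have hcover : volume.real B ≤
      volume.real ({z ∈ B | |halfPowerDiff p v z| ≤ 6 * V} ∪
        ({z | (6 * V) ^ 2 ≤ halfPowerDiff p v z ^ 2} ∩ B)) := by
    refine measureReal_mono (fun z hz => ?_) ?_
    · rcases le_total (|halfPowerDiff p v z|) (6 * V) with h | h
      · exact Or.inl ⟨hz, h⟩
      · refine Or.inr ⟨?_, hz⟩
        rw [Set.mem_ofPred_eq, ← sq_abs (halfPowerDiff p v z)]
        gcongr
    · exact ((measure_mono (Set.union_subset (Set.sep_subset _ _) Set.inter_subset_right)).trans_lt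
        hB.measure_lt_top).ne
  have := measureReal_union_le (μ := volume) {z ∈ B | |halfPowerDiff p v z| ≤ 6 * V}
    ({z | (6 * V) ^ 2 ≤ halfPowerDiff p v z ^ 2} ∩ B)
  linarith

theorem exists_volume_powerBall {p : ℝ} (hp1 : 1 ≤ p) {d : ℕ} (hd : 0 < d) :
    ∃ κ : ℝ, 0 < κ ∧ ∀ r : ℝ, 0 ≤ r → volume.real (powerBall p d (r ^ p)) = r ^ d * κ := by
  have hp : 0 < p := by linarith
  have : Nonempty (Fin d) := ⟨⟨0, hd⟩⟩
  refine ⟨(2 * Real.Gamma (1 / p + 1)) ^ d / Real.Gamma (d / p + 1), ?_, fun r hr => ?_⟩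
  · have := Real.Gamma_pos_of_pos (show 0 < 1 / p + 1 by positivity)
    have := Real.Gamma_pos_of_pos (show 0 < d / p + 1 by positivity)
    positivity
  · have heq : powerBall p d (r ^ p) = {x : Fin d → ℝ | (∑ i, |x i| ^ p) ^ (1 / p) ≤ r} := by
      ext z
      simp only [powerBall, Set.mem_ofPred_eq, one_div]
      rw [Real.rpow_inv_le_iff_of_pos (by positivity) hr hp]
    have := Real.Gamma_pos_of_pos (show 0 < 1 / p + 1 by positivity)
    have := Real.Gamma_pos_of_pos (show 0 < d / p + 1 by positivity)
    rw [heq, measureReal_def, volume_sum_rpow_le (Fin d) hp1, Fintype.card_fin, ENNReal.toReal_mul,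
      ENNReal.toReal_pow, ENNReal.toReal_ofReal hr, ENNReal.toReal_ofReal (by positivity)]

theorem mem_lpBall_iff {p : ℝ} (hp : 0 < p) {d : ℕ} {x u : Fin d → ℝ} {r : ℝ} (hr : 0 ≤ r) :
    u ∈ lpBall p x r ↔ ∑ i, |x i - u i| ^ p ≤ r ^ p := by
  simp only [lpBall, lpDist, Set.mem_ofPred_eq, one_div]
  exact Real.rpow_inv_le_iff_of_pos (by positivity) hr hp

theorem lpBall_eq_preimage_powerBall {p : ℝ} (hp : 0 < p) {d : ℕ} (x : Fin d → ℝ) {r : ℝ}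
    (hr : 0 ≤ r) : lpBall p x r = (fun u => u - x) ⁻¹' powerBall p d (r ^ p) := by
  ext u
  rw [mem_lpBall_iff hp hr]
  simp [powerBall, abs_sub_comm]

theorem volume_lpBall {p : ℝ} (hp : 0 < p) {d : ℕ} (x : Fin d → ℝ) {r : ℝ} (hr : 0 ≤ r) :
    volume (lpBall p x r) = volume (powerBall p d (r ^ p)) := by
  simp only [lpBall_eq_preimage_powerBall hp x hr, sub_eq_add_neg]
  exact measure_preimage_add_right _ _ _

theorem volume_real_le_lpBall_inter {p : ℝ} (hp : 0 < p) {d : ℕ} {x y : Fin d → ℝ} {w : ℝ}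
    (hw : 0 ≤ w) {T : Set (Fin d → ℝ)}
    (hT : ∀ z ∈ T, ∑ i, |z i + (y i - x i) / 2| ^ p ≤ w ^ p ∧
      ∑ i, |z i - (y i - x i) / 2| ^ p ≤ w ^ p) :
    volume.real T ≤ volume.real (lpBall p x w ∩ lpBall p y w) := by
  have hfin : volume (lpBall p x w ∩ lpBall p y w) ≠ ⊤ := by
    refine ((measure_mono Set.inter_subset_left).trans_lt ?_).ne
    rw [volume_lpBall hp x hw]
    exact (isCompact_powerBall hp d _).measure_lt_top
  have htrans : volume ((fun u => u + -((1 / 2 : ℝ) • (x + y))) ⁻¹' T) = volume T :=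
    measure_preimage_add_right _ _ _
  rw [measureReal_def, ← htrans, ← measureReal_def]
  refine measureReal_mono (fun u hu => ?_) hfin
  obtain ⟨h1, h2⟩ := hT _ hu
  refine ⟨(mem_lpBall_iff hp hw).2 (le_trans (le_of_eq ?_) h1),
    (mem_lpBall_iff hp hw).2 (le_trans (le_of_eq ?_) h2)⟩ <;>
  · refine Finset.sum_congr rfl fun i _ => ?_
    rw [abs_sub_comm]
    congr 2
    simp only [Pi.add_apply, Pi.neg_apply, Pi.smul_apply, smul_eq_mul]
    ring

theorem sum_abs_add_rpow_le_of_mem_powerBall {p : ℝ} (hp1 : 1 ≤ p) {d : ℕ} {a b : ℝ}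
    (ha : 0 ≤ a) (hb : 0 ≤ b) {z v : Fin d → ℝ} (hz : ∑ i, |z i| ^ p ≤ a ^ p)
    (hv : ∑ i, |v i| ^ p ≤ b ^ p) : ∑ i, |z i + v i| ^ p ≤ (a + b) ^ p := by
  have hp : 0 < p := by linarith
  have h := Real.Lp_add_le Finset.univ z v hp1
  simp only [one_div] at h
  rw [← Real.rpow_inv_le_iff_of_pos (by positivity) (by positivity) hp] at hz hv ⊢
  linarith

theorem sum_abs_add_sub_rpow_le {p : ℝ} (hp1 : 1 ≤ p) (hp2 : p ≤ 2) {d : ℕ} {R L : ℝ}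
    {z v : Fin d → ℝ} (hz : ∑ i, |z i| ^ p ≤ R) (hL : |halfPowerDiff p v z| ≤ L) :
    ∑ i, |z i + v i| ^ p ≤ R + ∑ i, |v i| ^ p + L ∧
      ∑ i, |z i - v i| ^ p ≤ R + ∑ i, |v i| ^ p + L := by
  have hsum := Finset.sum_le_sum fun i (_ : i ∈ Finset.univ) =>
    abs_add_rpow_add_abs_sub_rpow_le hp1 hp2 (z i) (v i)
  rw [← Finset.mul_sum, Finset.sum_add_distrib, Finset.sum_add_distrib] at hsum
  rw [halfPowerDiff, ← Finset.sum_div, Finset.sum_sub_distrib, abs_le] at hL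
  constructor <;> linarith

theorem exp_neg_two_mul_le_one_sub {q : ℝ} (hq0 : 0 ≤ q) (hq : q ≤ 1 / 2) :
    Real.exp (-(2 * q)) ≤ 1 - q := by
  rw [Real.exp_neg]
  refine inv_le_of_inv_le₀ (by linarith) ?_
  refine le_trans ?_ (Real.add_one_le_exp (2 * q))
  rw [inv_le_iff_one_le_mul₀ (by linarith)]
  nlinarith

theorem exp_le_volume_lpBall_inter {p : ℝ} (hp1 : 1 ≤ p) (hp2 : p ≤ 2) {d : ℕ} (hd : 0 < d)
    {w : ℝ} (hw : 0 < w) {x y : Fin d → ℝ} (hlow : w ^ p ≤ d * ∑ i, |x i - y i| ^ p)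
    (hup : ∑ i, |x i - y i| ^ p ≤ (w / 3) ^ p) :
    Real.exp (-(14 * d * ((∑ i, |x i - y i| ^ p) / w ^ p))) *
      volume.real (powerBall p d (w ^ p)) ≤
      2 * volume.real (lpBall p x w ∩ lpBall p y w) := by
  have hp : 0 < p := by linarith
  obtain ⟨κ, hκ, hvol⟩ := exists_volume_powerBall hp1 hd
  have hd' : (0 : ℝ) < d := by exact_mod_cast hd
  set S := ∑ i, |x i - y i| ^ p with hS
  have hW : 0 < w ^ p := by positivity
  set v : Fin d → ℝ := fun i => (y i - x i) / 2 with hv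
  obtain ⟨V, hVdef⟩ : ∃ V, V = ∑ i, |v i| ^ p := ⟨_, rfl⟩
  have hVS : V * 2 ^ p = S := by
    rw [hVdef, hS, Finset.sum_mul]
    refine Finset.sum_congr rfl fun i _ => ?_
    rw [← Real.mul_rpow (abs_nonneg _) (by norm_num), abs_sub_comm (x i)]
    congr 1
    simp only [hv, abs_div, abs_two]
    ring
  have hV : 0 < V := by
    have : 0 < d * S := hW.trans_le hlow
    rw [← hVS] at this
    by_contra! hneg
    have h2 : (0 : ℝ) < 2 ^ p := by positivity
    nlinarith [mul_nonneg hd'.le (mul_nonneg (neg_nonneg.2 hneg) h2.le)]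
  have hVS_le : V ≤ S := by
    rw [← hVS]
    exact le_mul_of_one_le_right hV.le (Real.one_le_rpow (by norm_num) hp.le)
  have hS4 : S ≤ 4 * V := by
    have : (2 : ℝ) ^ p ≤ 2 ^ (2 : ℝ) := Real.rpow_le_rpow_of_exponent_le (by norm_num) hp2
    norm_num at this
    rw [← hVS]
    nlinarith
  have hexp : Real.exp (-(14 * d * (S / w ^ p))) ≤ Real.exp (-(14 * (V / w ^ p))) ^ d := by
    rw [← Real.exp_nat_mul, Real.exp_le_exp]
    have : V / w ^ p ≤ S / w ^ p := by gcongr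
    nlinarith
  rw [hvol w hw.le]
  rcases le_or_gt (14 * V) (w ^ p) with hcase | hcase
  · set q := 7 * (V / w ^ p) with hq
    have hq0 : 0 < q := by positivity
    have hq2 : q ≤ 1 / 2 := by
      have : V / w ^ p ≤ 1 / 14 := by rw [div_le_iff₀ hW]; linarith
      linarith
    have hqW : w ^ p * q = 7 * V := by rw [hq]; field_simp
    have hR : (w * (1 - q)) ^ p ≤ w ^ p - 7 * V := by
      rw [Real.mul_rpow hw.le (by linarith), ← hqW]
      have : (1 - q) ^ p ≤ 1 - q :=
        Real.rpow_le_self_of_le_one (by linarith) (by linarith) hp1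
      nlinarith
    have hhalf := half_volume_powerBall_le hp1 hp2 (R := (w * (1 - q)) ^ p) (v := v) hd
      (hVdef ▸ hV) (by rw [← hVdef]; nlinarith)
    rw [hvol _ (mul_nonneg hw.le (by linarith))] at hhalf
    have hsub := volume_real_le_lpBall_inter hp hw.le (x := x) (y := y)
      (T := {z ∈ powerBall p d ((w * (1 - q)) ^ p) |
        |halfPowerDiff p v z| ≤ 6 * ∑ i, |v i| ^ p}) (by
        rintro z ⟨hz, hzL⟩
        obtain ⟨h1, h2⟩ := sum_abs_add_sub_rpow_le hp1 hp2 hz hzL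
        exact ⟨h1.trans (by linarith), h2.trans (by linarith)⟩)
    have hqexp : Real.exp (-(14 * (V / w ^ p))) ≤ 1 - q := by
      convert exp_neg_two_mul_le_one_sub hq0.le hq2 using 3
      rw [hq]; ring
    calc _ ≤ (1 - q) ^ d * (w ^ d * κ) := by
          gcongr
          exact hexp.trans (by gcongr)
      _ = (w * (1 - q)) ^ d * κ := by rw [mul_pow]; ring
      _ ≤ _ := by linarith
  · have hvle : ∑ i, |v i| ^ p ≤ (w / 6) ^ p := by
      rw [← hVdef]
      have h2 : (0 : ℝ) < 2 ^ p := by positivity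
      refine le_of_mul_le_mul_right ?_ h2
      rw [hVS, ← Real.mul_rpow (by positivity) (by norm_num)]
      rwa [show w / 6 * 2 = w / 3 by ring]
    have hsub := volume_real_le_lpBall_inter hp hw.le (x := x) (y := y)
      (T := powerBall p d ((w * (5 / 6)) ^ p)) (by
        intro z hz
        have hsum : w * (5 / 6) + w / 6 = w := by ring
        constructor
        · simpa only [hsum] using
            sum_abs_add_rpow_le_of_mem_powerBall hp1 (by positivity) (by positivity) hz hvle
        · simpa only [hsum, ← sub_eq_add_neg] using
            sum_abs_add_rpow_le_of_mem_powerBall hp1 (b := w / 6)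
              (v := fun i => -v i) (by positivity) (by positivity) hz (by simpa only [abs_neg] using hvle))
    rw [hvol _ (by positivity)] at hsub
    have hle : Real.exp (-(14 * (V / w ^ p))) ≤ 5 / 6 := by
      have h1 : 1 < 14 * (V / w ^ p) := by rw [← mul_div_assoc, lt_div_iff₀ hW]; linarith
      calc Real.exp (-(14 * (V / w ^ p))) ≤ Real.exp (-(2 * (1 / 2))) := by
            rw [Real.exp_le_exp]; linarith
        _ ≤ 1 - 1 / 2 := exp_neg_two_mul_le_one_sub (by norm_num) le_rfl
        _ ≤ 5 / 6 := by norm_num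
    calc _ ≤ (5 / 6) ^ d * (w ^ d * κ) := by
          gcongr
          exact hexp.trans (by gcongr)
      _ = (w * (5 / 6)) ^ d * κ := by rw [mul_pow]; ring
      _ ≤ _ := by
        have : 0 ≤ volume.real (lpBall p x w ∩ lpBall p y w) := measureReal_nonneg
        linarith

/-- **Volume ratio of intersecting `ℓ_p` balls (far regime).**  There are universal constants
`c, C > 0` such that for every `p ∈ [1,2]`, `d ≥ 1`, `w > 0` and points `x, y ∈ ℝ^d` with
`d^{-1/p}·w ≤ ‖x-y‖_p ≤ w/3`, one has
`vol(B_p(x,w) ∩ B_p(y,w)) / vol(B_p(x,w) ∪ B_p(y,w)) ≥ c · exp(-C·d·(‖x-y‖_p/w)^p)`. -/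
theorem lp_ball_intersection_volume_ratio :
    ∃ c C : ℝ, 0 < c ∧ 0 < C ∧
      ∀ p : ℝ, 1 ≤ p → p ≤ 2 →
        ∀ d : ℕ, 1 ≤ d → ∀ w : ℝ, 0 < w →
          ∀ x y : Fin d → ℝ,
            (d : ℝ) ^ (-(1 / p)) * w ≤ lpDist p x y → lpDist p x y ≤ w / 3 →
            c * Real.exp (-(C * d * (lpDist p x y / w) ^ p)) ≤
              (volume (lpBall p x w ∩ lpBall p y w)).toReal /
                (volume (lpBall p x w ∪ lpBall p y w)).toReal := by
  refine ⟨1 / 4, 14, by norm_num, by norm_num, ?_⟩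
  intro p hp1 hp2 d hd w hw x y hlow hup
  have hp : 0 < p := by linarith
  have hd' : (0 : ℝ) < d := by exact_mod_cast hd
  have hS0 : 0 ≤ ∑ i, |x i - y i| ^ p := by positivity
  have hD0 : 0 ≤ lpDist p x y := by unfold lpDist; positivity
  have hDp : lpDist p x y ^ p = ∑ i, |x i - y i| ^ p := by
    rw [lpDist, one_div, Real.rpow_inv_rpow hS0 hp.ne']
  have hlow' : w ^ p ≤ d * ∑ i, |x i - y i| ^ p := by
    have h := Real.rpow_le_rpow (by positivity) hlow hp.le
    rw [hDp, Real.mul_rpow (by positivity) hw.le, ← Real.rpow_mul hd'.le,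
      show -(1 / p) * p = -1 by field_simp, Real.rpow_neg_one, inv_mul_le_iff₀ hd'] at h
    exact h
  have hup' : ∑ i, |x i - y i| ^ p ≤ (w / 3) ^ p := by
    rw [← hDp]
    gcongr
  have hmain := exp_le_volume_lpBall_inter hp1 hp2 hd hw hlow' hup'
  rw [Real.div_rpow hD0 hw.le, hDp]
  simp only [← measureReal_def]
  have hball (u : Fin d → ℝ) :
      volume.real (lpBall p u w) = volume.real (powerBall p d (w ^ p)) := by
    rw [measureReal_def, volume_lpBall hp u hw.le, measureReal_def]
  have hunion := measureReal_union_le (μ := volume) (lpBall p x w) (lpBall p y w)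
  rw [hball, hball] at hunion
  obtain ⟨κ, hκ, hvol⟩ := exists_volume_powerBall hp1 hd
  have hpos : 0 < volume.real (powerBall p d (w ^ p)) := by
    rw [hvol w hw.le]
    positivity
  have hunion_pos : 0 < volume.real (lpBall p x w ∪ lpBall p y w) := by
    rw [← hball x] at hpos
    refine hpos.trans_le (measureReal_mono Set.subset_union_left ?_)
    refine ((measure_union_le _ _).trans_lt ?_).ne
    rw [volume_lpBall hp x hw.le, volume_lpBall hp y hw.le]
    exact ENNReal.add_lt_top.2 ⟨(isCompact_powerBall hp d _).measure_lt_top,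
      (isCompact_powerBall hp d _).measure_lt_top⟩
  rw [le_div_iff₀ hunion_pos]
  have hE := Real.exp_nonneg (-(14 * d * ((∑ i, |x i - y i| ^ p) / w ^ p)))
  have := mul_le_mul_of_nonneg_left hunion hE
  linarith
end

section
/- There exists a universal constant C > 0 such that for every integer n ≥ 1 there is a set E of unordered pairs of elements of {0,1,…,n−1} with |E| ≤ C·n·(1 + log n), such that for all 0 ≤ i ≤ j ≤ n−1 there exists l with i ≤ l ≤ j, where (l = i or {i,l} ∈ E) and (l = j or {l,j} ∈ E). (This is a 2-hop 1-spanner of the n-vertex path graph: the monotone 2-hop path i → l → j has length exactly |j − i| in the path metric.) -/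
/-- If `i ≤ j` lie in a common dyadic block of length `2 ^ K`, then either `i = j`, or for some
`k < K` they lie in consecutive dyadic blocks of length `2 ^ k`. -/
theorem exists_consecutive_dyadic_blocks {i j : ℕ} (hij : i ≤ j) (K : ℕ)
    (h : i / 2 ^ K = j / 2 ^ K) : i = j ∨ ∃ k < K, i / 2 ^ k + 1 = j / 2 ^ k := by
  induction K with
  | zero => left; simpa using h
  | succ K ih =>
    by_cases hK : i / 2 ^ K = j / 2 ^ K
    · exact (ih hK).imp_right fun ⟨k, hk, e⟩ => ⟨k, hk.trans K.lt_succ_self, e⟩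
    · have hle : i / 2 ^ K ≤ j / 2 ^ K := Nat.div_le_div_right hij
      rw [pow_succ, ← Nat.div_div_eq_div_mul, ← Nat.div_div_eq_div_mul] at h
      exact .inr ⟨K, K.lt_succ_self, by omega⟩

/-- The edges joining each vertex to the start of its dyadic block of length `2 ^ k` and to the
start of the next one, for all `k < K`. -/
def dyadicEdges (n K : ℕ) [NeZero n] : Finset (Sym2 (Fin n)) :=
  (Finset.univ ×ˢ Finset.range K).image
      (fun p : Fin n × ℕ => s(p.1, Fin.ofNat n ((p.1 / 2 ^ p.2 + 1) * 2 ^ p.2))) ∪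
    (Finset.univ ×ˢ Finset.range K).image
      (fun p : Fin n × ℕ => s(Fin.ofNat n (p.1 / 2 ^ p.2 * 2 ^ p.2), p.1))

theorem card_dyadicEdges_le (n K : ℕ) [NeZero n] : (dyadicEdges n K).card ≤ 2 * (n * K) := by
  have hcard : ((Finset.univ : Finset (Fin n)) ×ˢ Finset.range K).card = n * K := by simp
  calc (dyadicEdges n K).card ≤ n * K + n * K :=
        (Finset.card_union_le _ _).trans
          (add_le_add (hcard ▸ Finset.card_image_le) (hcard ▸ Finset.card_image_le))
    _ = 2 * (n * K) := by ring

theorem exists_two_hop_dyadicEdges {n K : ℕ} [NeZero n] (hK : n ≤ 2 ^ K) {i j : Fin n}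
    (hij : i ≤ j) :
    ∃ l : Fin n, i ≤ l ∧ l ≤ j ∧
      (l = i ∨ s(i, l) ∈ dyadicEdges n K) ∧ (l = j ∨ s(l, j) ∈ dyadicEdges n K) := by
  have hblock : i.val / 2 ^ K = j.val / 2 ^ K := by
    rw [Nat.div_eq_of_lt (i.2.trans_le hK), Nat.div_eq_of_lt (j.2.trans_le hK)]
  obtain h | ⟨k, hk, h⟩ := exists_consecutive_dyadic_blocks (Fin.le_def.1 hij) K hblock
  · exact ⟨i, le_rfl, hij, .inl rfl, .inl (Fin.ext h)⟩
  · have hle : j.val / 2 ^ k * 2 ^ k ≤ j := Nat.div_mul_le_self _ _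
    have hlt : j.val / 2 ^ k * 2 ^ k < n := hle.trans_lt j.2
    have hval : (Fin.ofNat n (j.val / 2 ^ k * 2 ^ k)).val = j.val / 2 ^ k * 2 ^ k :=
      Nat.mod_eq_of_lt hlt
    refine ⟨Fin.ofNat n (j.val / 2 ^ k * 2 ^ k), ?_, ?_, .inr ?_, .inr ?_⟩
    · rw [Fin.le_def, hval, ← h, mul_comm]
      exact (Nat.lt_mul_div_succ _ (by positivity)).le
    · rwa [Fin.le_def, hval]
    · exact Finset.mem_union_left _ (Finset.mem_image.2 ⟨(i, k), by simpa using hk, by simp [h]⟩)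
    · exact Finset.mem_union_right _ (Finset.mem_image.2 ⟨(j, k), by simpa using hk, rfl⟩)

theorem natLog_two_add_one_le {n : ℕ} (hn : 1 ≤ n) :
    ((Nat.log 2 n + 1 : ℕ) : ℝ) ≤ 2 * (1 + Real.log n) := by
  have hpow : ((2 : ℝ) ^ Nat.log 2 n) ≤ n := by
    exact_mod_cast Nat.pow_log_le_self 2 (by omega)
  have hlog := Real.log_le_log (by positivity) hpow
  rw [Real.log_pow] at hlog
  have htwo := Real.log_two_gt_d9
  have hnonneg : (0 : ℝ) ≤ Nat.log 2 n := by positivity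
  push_cast
  nlinarith

/-- **2-hop 1-spanner of the path graph.**  There is a universal constant `C > 0` such that for
every `n ≥ 1` there is a set `E` of unordered pairs of `{0,…,n-1}` with
`|E| ≤ C·n·(1 + log n)`, such that for all `i ≤ j` there is `l` with `i ≤ l ≤ j` where
`{i,l}` and `{l,j}` are (possibly degenerate) edges of `E`. -/
theorem path_two_hop_spanner :
    ∃ C : ℝ, 0 < C ∧
      ∀ n : ℕ, 1 ≤ n →
        ∃ E : Finset (Sym2 (Fin n)),
          (E.card : ℝ) ≤ C * n * (1 + Real.log n) ∧
          ∀ i j : Fin n, i ≤ j →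
            ∃ l : Fin n, i ≤ l ∧ l ≤ j ∧
              (l = i ∨ s(i, l) ∈ E) ∧ (l = j ∨ s(l, j) ∈ E) := by
  refine ⟨4, by norm_num, fun n hn => ?_⟩
  have : NeZero n := ⟨by omega⟩
  refine ⟨dyadicEdges n (Nat.log 2 n + 1), ?_, fun i j hij =>
    exists_two_hop_dyadicEdges (Nat.lt_pow_succ_log_self one_lt_two n).le hij⟩
  calc ((dyadicEdges n (Nat.log 2 n + 1)).card : ℝ)
      ≤ 2 * (n * (Nat.log 2 n + 1 : ℕ)) := by exact_mod_cast card_dyadicEdges_le n _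
    _ ≤ 2 * (n * (2 * (1 + Real.log n))) := by gcongr; exact natLog_two_add_one_le hn
    _ = 4 * n * (1 + Real.log n) := by ring
end

section
/- There exists a universal constant C > 0 such that for all integers n ≥ 1 and f ≥ 1 there is a set E of unordered pairs of elements of {0,1,…,n−1} with |E| ≤ C·n·(f+1)·(1 + log n), such that for every set F ⊆ {0,1,…,n−1} with |F| ≤ f and all 0 ≤ i ≤ j ≤ n−1 with i ∉ F and j ∉ F, there exists l ∉ F with i ≤ l ≤ j, where (l = i or {i,l} ∈ E) and (l = j or {l,j} ∈ E). (This is a 2-hop f-fault-tolerant 1-spanner of the n-vertex path graph.) -/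
/-- An interval of `Fin n` cut out by natural numbers `a ≤ v < b` has at most `b - a` elements. -/
theorem card_fin_interval_le (n a b : ℕ) :
    (Finset.univ.filter fun v : Fin n => a ≤ v.val ∧ v.val < b).card ≤ b - a := by
  rw [← Nat.card_Ico]
  refine Finset.card_le_card_of_injOn Fin.val ?_ Fin.val_injective.injOn
  intro v hv
  simpa using hv

/-- A set of `f + 1` consecutive vertices is not contained in a set of at most `f` vertices. -/
theorem exists_notMem_of_card_le {n f c : ℕ} (hc : c + f < n) (F : Finset (Fin n))
    (hF : F.card ≤ f) : ∃ l : Fin n, l ∉ F ∧ c ≤ l.val ∧ l.val ≤ c + f := by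
  by_contra! h
  have hsub : Finset.Icc c (c + f) ⊆ F.image Fin.val := by
    intro x hx
    rw [Finset.mem_Icc] at hx
    have hxn : x < n := by omega
    refine Finset.mem_image.2 ⟨⟨x, hxn⟩, ?_, rfl⟩
    by_contra hxF
    have := h ⟨x, hxn⟩ hxF hx.1
    simp only at this
    omega
  have h₁ := Finset.card_le_card hsub
  have h₂ : (F.image Fin.val).card ≤ F.card := Finset.card_image_le
  rw [Nat.card_Icc] at h₁
  omega

/-- Divide and conquer: a subinterval with fewer than `2 ^ d` vertices has a 2-hop
`f`-fault-tolerant 1-spanner with at most `d * (f + 1)` edges per vertex. -/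
theorem exists_interval_spanner (n f d : ℕ) : ∀ a b : ℕ, b - a < 2 ^ d →
    ∃ E : Finset (Sym2 (Fin n)), E.card ≤ d * ((f + 1) * (b - a)) ∧
      ∀ F : Finset (Fin n), F.card ≤ f →
        ∀ i j : Fin n, i ∉ F → j ∉ F → i ≤ j → a ≤ i.val → j.val < b →
          ∃ l : Fin n, l ∉ F ∧ i ≤ l ∧ l ≤ j ∧
            (l = i ∨ s(i, l) ∈ E) ∧ (l = j ∨ s(l, j) ∈ E) := by
  classical
  induction d with
  | zero =>
    intro a b hab
    refine ⟨∅, by simp, fun F _ i j _ _ hij hai hjb => ?_⟩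
    rw [pow_zero] at hab
    rw [Fin.le_def] at hij
    omega
  | succ d ih =>
    intro a b hab
    rw [pow_succ] at hab
    obtain ⟨c, hc⟩ : ∃ c, c = (a + b) / 2 := ⟨_, rfl⟩
    obtain ⟨L, hLcard, hL⟩ := ih a c (by omega)
    obtain ⟨R, hRcard, hR⟩ := ih (c + f + 1) b (by omega)
    obtain ⟨I, hI⟩ : ∃ I : Finset (Fin n),
      I = Finset.univ.filter fun v => a ≤ v.val ∧ v.val < b := ⟨_, rfl⟩
    obtain ⟨B, hB⟩ : ∃ B : Finset (Fin n),
      B = Finset.univ.filter fun v => c ≤ v.val ∧ v.val < c + f + 1 := ⟨_, rfl⟩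
    have hIcard : I.card ≤ b - a := hI ▸ card_fin_interval_le n a b
    have hBcard : B.card ≤ f + 1 := by
      have := card_fin_interval_le n c (c + f + 1)
      rw [← hB] at this
      omega
    obtain ⟨M, hM⟩ : ∃ M : Finset (Sym2 (Fin n)),
      M = (B ×ˢ I).image fun p => s(p.1, p.2) := ⟨_, rfl⟩
    have hMcard : M.card ≤ (f + 1) * (b - a) := by
      rw [hM]
      refine Finset.card_image_le.trans ?_
      rw [Finset.card_product]
      exact Nat.mul_le_mul hBcard hIcard
    have hMmem : ∀ u v : Fin n, c ≤ u.val → u.val ≤ c + f → a ≤ v.val → v.val < b →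
        s(u, v) ∈ M := by
      intro u v h₁ h₂ h₃ h₄
      rw [hM]
      refine Finset.mem_image.2 ⟨(u, v), Finset.mem_product.2 ⟨?_, ?_⟩, rfl⟩
      · simpa [hB] using ⟨h₁, by omega⟩
      · simpa [hI] using ⟨h₃, h₄⟩
    refine ⟨M ∪ (L ∪ R), ?_, ?_⟩
    · have h₁ := Finset.card_union_le M (L ∪ R)
      have h₂ := Finset.card_union_le L R
      by_cases hab' : a ≤ b
      · have h₃ : d * ((f + 1) * (c - a)) + d * ((f + 1) * (b - (c + f + 1))) ≤
            d * ((f + 1) * (b - a)) := by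
          rw [← mul_add, ← mul_add]
          gcongr
          omega
        rw [add_mul, one_mul]
        omega
      · have h₃ : c - a = 0 := by omega
        have h₄ : b - (c + f + 1) = 0 := by omega
        have h₅ : b - a = 0 := by omega
        simp only [h₃, h₄, h₅, mul_zero] at *
        omega
    · intro F hF i j hi hj hij hai hjb
      have hij' : i.val ≤ j.val := hij
      have haj : a ≤ j.val := by omega
      have hib : i.val < b := by omega
      have mono : ∀ S ⊆ M ∪ (L ∪ R),
          (∃ l : Fin n, l ∉ F ∧ i ≤ l ∧ l ≤ j ∧
            (l = i ∨ s(i, l) ∈ S) ∧ (l = j ∨ s(l, j) ∈ S)) →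
          ∃ l : Fin n, l ∉ F ∧ i ≤ l ∧ l ≤ j ∧
            (l = i ∨ s(i, l) ∈ M ∪ (L ∪ R)) ∧ (l = j ∨ s(l, j) ∈ M ∪ (L ∪ R)) := by
        rintro S hS ⟨l, h₁, h₂, h₃, h₄, h₅⟩
        exact ⟨l, h₁, h₂, h₃, h₄.imp_right (@hS _), h₅.imp_right (@hS _)⟩
      by_cases hjc : j.val < c
      · exact mono L (by grind) (hL F hF i j hi hj hij hai hjc)
      by_cases hic : c + f < i.val
      · exact mono R (by grind) (hR F hF i j hi hj hij hic hjb)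
      refine mono M Finset.subset_union_left ?_
      by_cases hiB : c ≤ i.val
      · exact ⟨i, hi, le_rfl, hij, .inl rfl, .inr (hMmem i j hiB (by omega) haj hjb)⟩
      by_cases hjB : j.val ≤ c + f
      · refine ⟨j, hj, hij, le_rfl, .inr ?_, .inl rfl⟩
        rw [Sym2.eq_swap]
        exact hMmem j i (by omega) hjB hai hib
      obtain ⟨l, hlF, hcl, hlc⟩ := exists_notMem_of_card_le (by omega : c + f < n) F hF
      refine ⟨l, hlF, Fin.le_def.2 (by omega), Fin.le_def.2 (by omega), .inr ?_,
        .inr (hMmem l j hcl hlc haj hjb)⟩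
      rw [Sym2.eq_swap]
      exact hMmem l i hcl hlc hai hib

/-- The binary logarithm is at most twice the natural logarithm. -/
theorem nat_log_two_le_two_mul_log (n : ℕ) (hn : 1 ≤ n) :
    (Nat.log 2 n : ℝ) ≤ 2 * Real.log n := by
  have h₁ : (2 : ℝ) ^ Nat.log 2 n ≤ n := by
    exact_mod_cast Nat.pow_log_le_self 2 (by omega)
  have h₂ := Real.log_le_log (by positivity) h₁
  rw [Real.log_pow] at h₂
  have h₃ := Real.log_two_gt_d9
  have h₄ : (0 : ℝ) ≤ Nat.log 2 n := by positivity
  nlinarith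


/-- **2-hop `f`-fault-tolerant 1-spanner of the path graph.**  There is a universal constant
`C > 0` such that for all `n, f ≥ 1` there is a set `E` of unordered pairs of `{0,…,n-1}` with
`|E| ≤ C·n·(f+1)·(1 + log n)`, such that for every faulty set `F` with `|F| ≤ f` and all
surviving `i ≤ j` there is a surviving `l` with `i ≤ l ≤ j` where `{i,l}` and `{l,j}` are
(possibly degenerate) edges of `E`. -/
theorem path_two_hop_fault_tolerant_spanner :
    ∃ C : ℝ, 0 < C ∧
      ∀ n f : ℕ, 1 ≤ n → 1 ≤ f →
        ∃ E : Finset (Sym2 (Fin n)),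
          (E.card : ℝ) ≤ C * n * (f + 1) * (1 + Real.log n) ∧
          ∀ F : Finset (Fin n), F.card ≤ f →
            ∀ i j : Fin n, i ∉ F → j ∉ F → i ≤ j →
              ∃ l : Fin n, l ∉ F ∧ i ≤ l ∧ l ≤ j ∧
                (l = i ∨ s(i, l) ∈ E) ∧ (l = j ∨ s(l, j) ∈ E) := by
  refine ⟨2, two_pos, fun n f hn _ => ?_⟩
  obtain ⟨E, hcard, hE⟩ := exists_interval_spanner n f (Nat.log 2 n + 1) 0 n
    (Nat.lt_pow_succ_log_self one_lt_two n)
  refine ⟨E, ?_, fun F hF i j hi hj hij => hE F hF i j hi hj hij (Nat.zero_le _) j.isLt⟩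
  have h₁ : (E.card : ℝ) ≤ (Nat.log 2 n + 1) * ((f + 1) * n) := by
    exact_mod_cast hcard
  have h₂ : (Nat.log 2 n + 1 : ℝ) ≤ 2 * (1 + Real.log n) := by
    linarith [nat_log_two_le_two_mul_log n hn]
  calc (E.card : ℝ) ≤ (Nat.log 2 n + 1) * ((f + 1) * n) := h₁
    _ ≤ 2 * (1 + Real.log n) * ((f + 1) * n) := by gcongr
    _ = 2 * n * (f + 1) * (1 + Real.log n) := by ring
end

section
/- There exists a universal constant C > 0 with the following property. Let (X,d_X) be a finite metric space with n points admitting a (τ,ρ)-LSO with ρ ∈ (0,1/2). Then there is a set H of unordered pairs of points of X with |H| ≤ C·n·τ·(1 + log n) such that for every x,y ∈ X there exists z ∈ X with d_X(x,z) + d_X(z,y) ≤ (1 + 2ρ)·d_X(x,y), where each of the pairs {x,z} and {z,y} is either degenerate (its two points coincide) or belongs to H. (In particular H is a 2-hop (1+2ρ)-spanner of X.) -/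
/-- A `(τ, ρ)`-LSO for the distance function `dX` on `X`: a collection of at most `τ` linear
orders on `X` such that for every `x, y` there is an order `σ` in the collection such that
(w.l.o.g. `x ≤_σ y`) the points between `x` and `y` split into two consecutive intervals,
one contained in the ball of radius `ρ·dX x y` around `x`, the other around `y`. -/
def IsLSO {X : Type*} (dX : X → X → ℝ) (τ ρ : ℝ) : Prop :=
  ∃ (m : ℕ) (σ : Fin m → X → X → Prop),
    (m : ℝ) ≤ τ ∧ (∀ i, IsLinearOrder X (σ i)) ∧
    ∀ x y : X, ∃ i : Fin m,
      (∃ c : X, σ i x c ∧ σ i c y ∧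
        (∀ z : X, σ i x z → σ i z c → dX x z ≤ ρ * dX x y) ∧
        (∀ z : X, ¬ σ i z c → σ i z y → dX y z ≤ ρ * dX x y)) ∨
      (∃ c : X, σ i y c ∧ σ i c x ∧
        (∀ z : X, σ i y z → σ i z c → dX y z ≤ ρ * dX x y) ∧
        (∀ z : X, ¬ σ i z c → σ i z x → dX x z ≤ ρ * dX x y))

/-- The multiple of `2 ^ j` obtained by rounding `y` down is the one obtained by rounding `x` up,
for a suitable `j`. -/
theorem exists_div_two_pow_eq_succ {x y : ℕ} (h : x < y) : ∃ j, y / 2 ^ j = x / 2 ^ j + 1 := by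
  induction y using Nat.strong_induction_on generalizing x with
  | _ y ih =>
    by_cases hxy : x / 2 < y / 2
    · obtain ⟨j, hj⟩ := ih (y / 2) (by omega) hxy
      refine ⟨j + 1, ?_⟩
      rwa [pow_succ', ← Nat.div_div_eq_div_mul, ← Nat.div_div_eq_div_mul]
    · exact ⟨0, by simp; omega⟩

/-- A finite linearly ordered set is enumerated increasingly by an initial segment of `ℕ`. -/
theorem IsLinearOrder.exists_equiv_fin {X : Type*} [Fintype X] {r : X → X → Prop}
    (hr : IsLinearOrder X r) {n : ℕ} (hn : Fintype.card X = n) :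
    ∃ e : X ≃ Fin n, ∀ a b, r a b ↔ e a ≤ e b := by
  classical
  let : LinearOrder X :=
    { le := r
      le_refl := hr.refl
      le_trans := hr.trans
      le_antisymm := hr.antisymm
      le_total := hr.total
      toDecidableLE := Classical.decRel _ }
  let e := (Fintype.orderIsoFinOfCardEq X hn).symm
  exact ⟨e.toEquiv, fun a b => e.le_iff_le.symm⟩

/-- A path on `n` points has a 2-hop `1`-spanner with `O(n log n)` edges. -/
theorem IsLinearOrder.exists_two_hop {X : Type*} [Fintype X] {r : X → X → Prop}
    (hr : IsLinearOrder X r) :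
    ∃ H : Finset (Sym2 X),
      H.card ≤ 2 * (Fintype.card X * (Nat.log 2 (Fintype.card X) + 1)) ∧
      ∀ x y, r x y → x ≠ y → ∃ z, r x z ∧ r z y ∧ s(x, z) ∈ H ∧ s(z, y) ∈ H := by
  classical
  generalize hn : Fintype.card X = n
  obtain ⟨e, he⟩ := hr.exists_equiv_fin hn
  let p : X → ℕ → X := fun a t => if h : t < n then e.symm ⟨t, h⟩ else a
  let T : Finset (X × Fin (Nat.log 2 n + 1)) := Finset.univ
  have hT : T.card = n * (Nat.log 2 n + 1) := by simp [T, hn]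
  refine ⟨T.image (fun q => s(q.1, p q.1 (((e q.1 : ℕ) / 2 ^ (q.2 : ℕ) + 1) * 2 ^ (q.2 : ℕ)))) ∪
    T.image (fun q => s(p q.1 ((e q.1 : ℕ) / 2 ^ (q.2 : ℕ) * 2 ^ (q.2 : ℕ)), q.1)), ?_, ?_⟩
  · refine (Finset.card_union_le _ _).trans ?_
    rw [two_mul, ← hT]
    exact add_le_add Finset.card_image_le Finset.card_image_le
  · intro x y hxy hne
    have hlt : (e x : ℕ) < e y :=
      lt_of_le_of_ne ((he x y).1 hxy) fun h => hne (e.injective (Fin.ext h))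
    obtain ⟨j, hj⟩ := exists_div_two_pow_eq_succ hlt
    set t := (e y : ℕ) / 2 ^ j * 2 ^ j with ht
    have hty : t ≤ e y := Nat.div_mul_le_self _ _
    have hxt : (e x : ℕ) < t := by
      rw [ht, hj]
      exact Nat.lt_mul_of_div_lt (Nat.lt_succ_self _) (by positivity)
    have htn : t < n := hty.trans_lt (e y).2
    have hjn : j < Nat.log 2 n + 1 := by
      refine Nat.lt_succ_of_le (Nat.le_log_of_pow_le one_lt_two ?_)
      refine le_trans ?_ htn.le
      exact Nat.le_mul_of_pos_left _ (hj ▸ Nat.succ_pos _)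
    have hp : ∀ a, p a t = e.symm ⟨t, htn⟩ := fun a => dif_pos htn
    refine ⟨e.symm ⟨t, htn⟩, ?_, ?_, ?_, ?_⟩
    · rw [he, Equiv.apply_symm_apply]
      exact hxt.le
    · rw [he, Equiv.apply_symm_apply]
      exact hty
    · refine Finset.mem_union_left _ (Finset.mem_image.2 ⟨(x, ⟨j, hjn⟩), Finset.mem_univ _, ?_⟩)
      simp only [← hj, ← ht, hp]
    · refine Finset.mem_union_right _ (Finset.mem_image.2 ⟨(y, ⟨j, hjn⟩), Finset.mem_univ _, ?_⟩)
      simp only [← ht, hp]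

theorem Nat.log_two_le_two_mul_log (n : ℕ) : (Nat.log 2 n : ℝ) ≤ 2 * Real.log n := by
  have h := Real.natLog_le_logb n 2
  have h2 := Real.log_two_gt_d9
  have h0 := Real.log_natCast_nonneg n
  refine h.trans ?_
  rw [Real.logb, Nat.cast_ofNat, div_le_iff₀ (by linarith)]
  nlinarith

/-- A detour through a point close to one of the endpoints is short. -/
theorem dist_add_dist_le_of_close {X : Type*} [PseudoMetricSpace X] {x y z : X} {ρ : ℝ}
    (h : dist x z ≤ ρ * dist x y ∨ dist y z ≤ ρ * dist x y) :
    dist x z + dist z y ≤ (1 + 2 * ρ) * dist x y := by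
  have h1 := dist_triangle z x y
  have h2 := dist_triangle x y z
  rw [dist_comm z x] at h1
  rw [dist_comm z y] at *
  rcases h with h | h <;> linarith

/-- **2-hop spanner from an LSO.**  There is a universal constant `C > 0` such that every finite
metric space on `n` points admitting a `(τ, ρ)`-LSO with `ρ ∈ (0, 1/2)` has a 2-hop
`(1 + 2ρ)`-spanner with at most `C·n·τ·(1 + log n)` edges. -/
theorem two_hop_spanner_from_LSO :
    ∃ C : ℝ, 0 < C ∧
      ∀ (X : Type) [MetricSpace X] [Fintype X] (τ ρ : ℝ), 0 < ρ → ρ < 1 / 2 →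
        IsLSO (fun x y : X => dist x y) τ ρ →
        ∃ H : Finset (Sym2 X),
          (H.card : ℝ) ≤ C * Fintype.card X * τ * (1 + Real.log (Fintype.card X)) ∧
          ∀ x y : X, ∃ z : X,
            dist x z + dist z y ≤ (1 + 2 * ρ) * dist x y ∧
            (x = z ∨ s(x, z) ∈ H) ∧ (z = y ∨ s(z, y) ∈ H) := by
  classical
  refine ⟨4, by norm_num, fun X _ _ τ ρ _ _ ⟨m, σ, hm, hσ, hlso⟩ => ?_⟩
  choose K hKcard hK using fun i => (hσ i).exists_two_hop
  refine ⟨Finset.univ.biUnion K, ?_, fun x y => ?_⟩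
  · set n := Fintype.card X
    have hcard : (Finset.univ.biUnion K).card ≤ m * (2 * (n * (Nat.log 2 n + 1))) := by
      simpa using Finset.card_biUnion_le_card_mul Finset.univ K _ fun i _ => hKcard i
    have hlog := Nat.log_two_le_two_mul_log n
    have hlog0 := Real.log_natCast_nonneg n
    calc ((Finset.univ.biUnion K).card : ℝ)
        ≤ m * (2 * (n * (Nat.log 2 n + 1))) := by exact_mod_cast hcard
      _ ≤ τ * (2 * (n * (2 * (1 + Real.log n)))) := by
          gcongr
          · exact (Nat.cast_nonneg m).trans hm
          · linarith
      _ = 4 * n * τ * (1 + Real.log n) := by ring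
  · rcases eq_or_ne x y with rfl | hne
    · exact ⟨x, by simp, .inl rfl, .inl rfl⟩
    have hmem : ∀ {i q}, q ∈ K i → q ∈ Finset.univ.biUnion K := fun h =>
      Finset.mem_biUnion.2 ⟨_, Finset.mem_univ _, h⟩
    obtain ⟨i, ⟨c, hxc, hcy, hx, hy⟩ | ⟨c, hyc, hcx, hy, hx⟩⟩ := hlso x y
    · obtain ⟨z, hxz, hzy, h1, h2⟩ := hK i x y ((hσ i).trans _ _ _ hxc hcy) hne
      refine ⟨z, dist_add_dist_le_of_close ?_, .inr (hmem h1), .inr (hmem h2)⟩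
      by_cases hzc : σ i z c
      · exact .inl (hx z hxz hzc)
      · exact .inr (hy z hzc hzy)
    · obtain ⟨z, hyz, hzx, h1, h2⟩ := hK i y x ((hσ i).trans _ _ _ hyc hcx) hne.symm
      rw [Sym2.eq_swap] at h1 h2
      refine ⟨z, dist_add_dist_le_of_close ?_, .inr (hmem h2), .inr (hmem h1)⟩
      by_cases hzc : σ i z c
      · exact .inr (hy z hyz hzc)
      · exact .inl (hx z hzc hzx)
end

section
/- Let (X,d_X) be a finite metric space with n points admitting a (τ,ρ)-rooted LSO. Then there is a set H of unordered pairs of points of X with |H| ≤ n·τ such that for every u,v ∈ X there exists z ∈ X with d_X(u,z) + d_X(z,v) ≤ ρ·d_X(u,v), where each of the pairs {u,z} and {z,v} is either degenerate (its two points coincide) or belongs to H. (In particular H is a 2-hop ρ-spanner of X.) -/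
/-- A `(τ, ρ)`-rooted LSO for the distance function `dX` on `X`: a finite family of pairs
`(S i, r i)` with `r i ∈ S i ⊆ X`, where every point belongs to at most `τ` of the sets, and
every pair `u, v` has an index `i` with `u, v ∈ S i` and
`dX u (r i) + dX (r i) v ≤ ρ · dX u v`. -/
def IsRootedLSO {X : Type*} (dX : X → X → ℝ) (τ ρ : ℝ) : Prop :=
  ∃ (m : ℕ) (S : Fin m → Set X) (r : Fin m → X),
    (∀ i, r i ∈ S i) ∧
    (∀ x : X, ({i : Fin m | x ∈ S i}.ncard : ℝ) ≤ τ) ∧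
    ∀ u v : X, ∃ i : Fin m,
      u ∈ S i ∧ v ∈ S i ∧ dX u (r i) + dX (r i) v ≤ ρ * dX u v

/-- **2-hop spanner from a rooted LSO.**  Every finite metric space on `n` points admitting a
`(τ, ρ)`-rooted LSO has a 2-hop `ρ`-spanner with at most `n·τ` edges. -/
theorem two_hop_spanner_from_rooted_LSO :
    ∀ (X : Type) [MetricSpace X] [Fintype X] (τ ρ : ℝ),
      IsRootedLSO (fun x y : X => dist x y) τ ρ →
      ∃ H : Finset (Sym2 X),
        (H.card : ℝ) ≤ Fintype.card X * τ ∧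
        ∀ u v : X, ∃ z : X,
          dist u z + dist z v ≤ ρ * dist u v ∧
          (u = z ∨ s(u, z) ∈ H) ∧ (z = v ∨ s(z, v) ∈ H) := by
  classical
  rintro X _ _ τ ρ ⟨m, S, r, -, hτ, hρ⟩
  refine ⟨Finset.univ.biUnion fun x =>
    (Finset.univ.filter fun i => x ∈ S i).image fun i => s(x, r i), ?_, fun u v => ?_⟩
  · have hdeg : ∀ x : X,
        (((Finset.univ.filter fun i => x ∈ S i).image fun i => s(x, r i)).card : ℝ) ≤ τ := by
      intro x
      refine le_trans ?_ (hτ x)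
      rw [Set.ncard_eq_toFinset_card', Set.toFinset_ofPred]
      exact_mod_cast Finset.card_image_le
    calc _ ≤ ∑ x : X,
          (((Finset.univ.filter fun i => x ∈ S i).image fun i => s(x, r i)).card : ℝ) := by
          exact_mod_cast Finset.card_biUnion_le
      _ ≤ ∑ _x : X, τ := Finset.sum_le_sum fun x _ => hdeg x
      _ = Fintype.card X * τ := by simp
  · obtain ⟨i, hu, hv, h⟩ := hρ u v
    have hmem : ∀ x ∈ S i, s(x, r i) ∈ Finset.univ.biUnion fun x =>
        (Finset.univ.filter fun i => x ∈ S i).image fun i => s(x, r i) := by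
      intro x hx
      exact Finset.mem_biUnion.2 ⟨x, Finset.mem_univ x,
        Finset.mem_image_of_mem _ (Finset.mem_filter.2 ⟨Finset.mem_univ i, hx⟩)⟩
    exact ⟨r i, h, Or.inr (hmem u hu), Or.inr (Sym2.eq_swap ▸ hmem v hv)⟩
end

section
/- There exists a universal constant C > 0 with the following property. Let (X,d_X) be a finite metric space with n points admitting a (τ,ρ)-rooted LSO with ρ ≥ 1, and let f ≥ 1 be an integer. Then there is a set H of unordered pairs of points of X with |H| ≤ C·n·f·τ such that for every set F ⊆ X with |F| ≤ f and every x,y ∈ X \ F, there exists z ∈ X \ F with d_X(x,z) + d_X(z,y) ≤ 2ρ·d_X(x,y), where each of the pairs {x,z} and {z,y} is either degenerate (its two points coincide) or belongs to H. (In particular H is a 2-hop f-fault-tolerant 2ρ-spanner of X.) -/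
/-- Every finite set has a subset consisting of `k` points with smallest `g`-values
(or of all points, if there are fewer than `k`). -/
theorem Finset.exists_subset_card_le_minimal {X : Type*} (S : Finset X) (g : X → ℝ) (k : ℕ) :
    ∃ R ⊆ S, R.card ≤ k ∧ (R = S ∨ R.card = k) ∧
      ∀ x ∈ S, x ∉ R → ∀ z ∈ R, g z ≤ g x := by
  classical
  induction k with
  | zero => exact ⟨∅, by simp⟩
  | succ k ih =>
    obtain ⟨R, hRS, hcard, hR, hmin⟩ := ih
    by_cases hS : R = S
    · exact ⟨R, hRS, by lia, Or.inl hS, hmin⟩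
    · have hne : (S \ R).Nonempty :=
        Finset.sdiff_nonempty.2 fun h => hS (hRS.antisymm h)
      obtain ⟨m, hm, hmle⟩ := Finset.exists_min_image (S \ R) g hne
      obtain ⟨hmS, hmR⟩ := Finset.mem_sdiff.1 hm
      have hcard' : (insert m R).card = k + 1 := by
        rw [Finset.card_insert_of_notMem hmR, hR.resolve_left hS]
      refine ⟨insert m R, Finset.insert_subset hmS hRS, hcard'.le, Or.inr hcard', ?_⟩
      intro x hx hxR z hz
      rw [Finset.mem_insert, not_or] at hxR
      rcases Finset.mem_insert.1 hz with rfl | hz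
      · exact hmle x (Finset.mem_sdiff.2 ⟨hx, hxR.2⟩)
      · exact hmin x hx hxR.2 z hz

/-- If every point lies in at most `τ` of the sets `S i`, their sizes sum to at most
`card X * τ`. -/
theorem Finset.sum_card_le_card_mul {X ι : Type*} [Fintype X] [Fintype ι] [DecidableEq X]
    (S : ι → Finset X) (τ : ℝ) (h : ∀ x, ({i | x ∈ S i}.ncard : ℝ) ≤ τ) :
    ∑ i, ((S i).card : ℝ) ≤ Fintype.card X * τ := by
  have hswap : ∑ i, (S i).card = ∑ x : X, {i | x ∈ S i}.ncard := by
    have := Finset.sum_card_bipartiteAbove_eq_sum_card_bipartiteBelow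
      (s := (Finset.univ : Finset ι)) (t := (Finset.univ : Finset X)) (fun i x => x ∈ S i)
    simpa [Finset.bipartiteAbove, Finset.bipartiteBelow, Set.ncard_eq_toFinset_card'] using this
  rw [← Nat.cast_sum, hswap, Nat.cast_sum]
  calc ∑ x : X, ({i | x ∈ S i}.ncard : ℝ) ≤ ∑ _x : X, τ := Finset.sum_le_sum fun x _ => h x
    _ = Fintype.card X * τ := by simp

/-- Joining every set `T i` to at most `f + 1` points gives at most `2 * f * ∑ i, card (T i)`
edges. -/
theorem Finset.card_biUnion_image_product_le {X : Type*} {m f : ℕ} [DecidableEq X]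
    (R T : Fin m → Finset X) (hf : 1 ≤ f) (hR : ∀ i, (R i).card ≤ f + 1) :
    (Finset.univ.biUnion fun i => (R i ×ˢ T i).image fun p => s(p.1, p.2)).card ≤
      2 * f * ∑ i, (T i).card := by
  rw [Finset.mul_sum]
  refine Finset.card_biUnion_le.trans (Finset.sum_le_sum fun i _ => Finset.card_image_le.trans ?_)
  rw [Finset.card_product]
  exact Nat.mul_le_mul_right _ ((hR i).trans (by lia))

/-- **2-hop fault-tolerant spanner from a rooted LSO.**  There is a universal constant `C > 0`
such that every finite metric space on `n` points admitting a `(τ, ρ)`-rooted LSO with `ρ ≥ 1`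
has, for every `f ≥ 1`, a 2-hop `f`-fault-tolerant `2ρ`-spanner with at most `C·n·f·τ`
edges. -/
theorem two_hop_fault_tolerant_spanner_from_rooted_LSO :
    ∃ C : ℝ, 0 < C ∧
      ∀ (X : Type) [MetricSpace X] [Fintype X] (τ ρ : ℝ) (f : ℕ),
        1 ≤ ρ → 1 ≤ f →
        IsRootedLSO (fun x y : X => dist x y) τ ρ →
        ∃ H : Finset (Sym2 X),
          (H.card : ℝ) ≤ C * Fintype.card X * f * τ ∧
          ∀ F : Finset X, F.card ≤ f →
            ∀ x y : X, x ∉ F → y ∉ F →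
              ∃ z : X, z ∉ F ∧
                dist x z + dist z y ≤ 2 * ρ * dist x y ∧
                (x = z ∨ s(x, z) ∈ H) ∧ (z = y ∨ s(z, y) ∈ H) := by
  classical
  refine ⟨2, by norm_num, ?_⟩
  intro X _ _ τ ρ f hρ hf ⟨m, S, r, _, hτ, hpair⟩
  obtain ⟨T, hT⟩ : ∃ T : Fin m → Finset X, ∀ i x, x ∈ T i ↔ x ∈ S i :=
    ⟨fun i => (S i).toFinset, fun _ _ => Set.mem_toFinset⟩
  choose R hRT hRcard hRfull hRmin using fun i =>
    (T i).exists_subset_card_le_minimal (fun x => dist x (r i)) (f + 1)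
  let H : Finset (Sym2 X) :=
    Finset.univ.biUnion fun i => (R i ×ˢ T i).image fun p => s(p.1, p.2)
  have hH : ∀ {i a b}, a ∈ R i → b ∈ T i → s(a, b) ∈ H := fun {i a b} ha hb =>
    Finset.mem_biUnion.2 ⟨i, Finset.mem_univ _,
      Finset.mem_image.2 ⟨(a, b), Finset.mk_mem_product ha hb, rfl⟩⟩
  refine ⟨H, ?_, ?_⟩
  · have hsum : ∑ i, ((T i).card : ℝ) ≤ Fintype.card X * τ :=
      Finset.sum_card_le_card_mul T τ (by simpa only [hT] using hτ)
    calc (H.card : ℝ) ≤ (2 * f * ∑ i, (T i).card : ℕ) :=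
          Nat.cast_le.2 (Finset.card_biUnion_image_product_le R T hf hRcard)
      _ = (2 * f) * ∑ i, ((T i).card : ℝ) := by push_cast; rfl
      _ ≤ (2 * f) * (Fintype.card X * τ) :=
          mul_le_mul_of_nonneg_left hsum (mul_nonneg zero_le_two f.cast_nonneg)
      _ = 2 * Fintype.card X * f * τ := by ring
  · intro F hF x y hxF hyF
    obtain ⟨i, hx, hy, hxy⟩ := hpair x y
    rw [← hT] at hx hy
    have hdist : dist x y ≤ 2 * ρ * dist x y := by
      nlinarith [dist_nonneg (x := x) (y := y)]
    by_cases hxR : x ∈ R i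
    · exact ⟨x, hxF, by rwa [dist_self, zero_add], Or.inl rfl, Or.inr (hH hxR hy)⟩
    by_cases hyR : y ∈ R i
    · exact ⟨y, hyF, by rwa [dist_self, add_zero], Or.inr (Sym2.eq_swap ▸ hH hyR hx), Or.inl rfl⟩
    have hcard : (R i).card = f + 1 := (hRfull i).resolve_left fun h => hxR (h ▸ hx)
    obtain ⟨z, hzR, hzF⟩ := Finset.exists_mem_notMem_of_card_lt_card (s := F) (t := R i) (by lia)
    refine ⟨z, hzF, ?_, Or.inr (Sym2.eq_swap ▸ hH hzR hx), Or.inr (hH hzR hy)⟩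
    have hzx : dist z (r i) ≤ dist x (r i) := hRmin i x hx hxR z hzR
    have hzy : dist z (r i) ≤ dist y (r i) := hRmin i y hy hyR z hzR
    have hxz := dist_triangle_right x z (r i)
    have hzy' := dist_triangle_right z y (r i)
    have hsymm := dist_comm (r i) y
    beta_reduce at hxy
    linarith
end

section
/- There exists a universal constant C > 0 with the following property. Let (X,d_X) be a finite metric space, let τ ≥ 1 and ρ ≥ 1, and suppose that for every Δ > 0 there exist s ≤ τ partitions P_1,…,P_s of X such that every cluster of every P_i has diameter at most Δ, and for every x ∈ X there is some index i and some cluster Y ∈ P_i with the closed ball B(x, Δ/ρ) ⊆ Y (a (τ,ρ)-padded partition cover scheme). Then for every ε ∈ (0,1/2) there exist m ≤ C·(τ/ε)·log(ρ/ε) dominating ultrametrics u_1,…,u_m over X such that for all x,y ∈ X, min_{1 ≤ j ≤ m} u_j(x,y) ≤ ρ·(1+ε)·d_X(x,y). -/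
/-- `u` is a dominating ultrametric over the metric space `X`: it vanishes on the diagonal,
is symmetric, dominates the distance of `X` off the diagonal, and satisfies the strong
(ultrametric) triangle inequality. -/
def IsDominatingUltrametric {X : Type*} [MetricSpace X] (u : X → X → ℝ) : Prop :=
  (∀ x : X, u x x = 0) ∧
  (∀ x y : X, u x y = u y x) ∧
  (∀ x y : X, x ≠ y → dist x y ≤ u x y) ∧
  (∀ x y z : X, u x z ≤ max (u x y) (u y z))

/-- A nested sequence of partitions with diameters bounded by a monotone sequence `D` yields a
dominating ultrametric. -/
theorem exists_isDominatingUltrametric_of_monotone_setoid {X : Type*} [MetricSpace X] [Finite X]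
    (S : ℕ → Setoid X) (hS : Monotone S) (D : ℕ → ℝ) (hD : Monotone D) (hD0 : D 0 = 0)
    (hdist : ∀ k x y, S k x y → dist x y ≤ D k) :
    ∃ u : X → X → ℝ, IsDominatingUltrametric u ∧ ∀ k x y, S k x y → u x y ≤ D k := by
  classical
  set M : ℝ := Metric.diam (Set.univ : Set X)
  have hM : ∀ x y : X, dist x y ≤ M := fun x y =>
    Metric.dist_le_diam_of_mem Set.finite_univ.isBounded (Set.mem_univ x) (Set.mem_univ y)
  have hu : ∃ u : X → X → ℝ, ∀ x y r, u x y ≤ r ↔ M ≤ r ∨ ∃ k, S k x y ∧ D k ≤ r := by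
    refine ⟨fun x y => if h : ∃ k, S k x y then min M (D (Nat.find h)) else M, fun x y r => ?_⟩
    by_cases h : ∃ k, S k x y
    · simp only [h, dite_true, min_le_iff]
      refine or_congr_right ⟨fun hr => ⟨_, Nat.find_spec h, hr⟩, ?_⟩
      rintro ⟨k, hk, hr⟩
      exact (hD (Nat.find_min' h hk)).trans hr
    · simp only [h, dite_false]
      exact ⟨Or.inl, fun hr => hr.resolve_right fun ⟨k, hk, _⟩ => h ⟨k, hk⟩⟩
  obtain ⟨u, hu⟩ := hu
  have hle : ∀ k x y, S k x y → u x y ≤ D k := fun k x y hk =>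
    (hu x y _).2 (Or.inr ⟨k, hk, le_rfl⟩)
  have hge : ∀ x y, dist x y ≤ u x y := fun x y => by
    rcases (hu x y _).1 le_rfl with h | ⟨k, hk, h⟩
    · exact (hM x y).trans h
    · exact (hdist k x y hk).trans h
  refine ⟨u, ⟨fun x => le_antisymm ?_ ?_, fun x y => eq_of_forall_ge_iff fun r => ?_,
    fun x y _ => hge x y, fun x y z => ?_⟩, hle⟩
  · exact hD0 ▸ hle 0 x x ((S 0).refl x)
  · exact dist_nonneg.trans (hge x x)
  · rw [hu, hu]
    exact or_congr_right (exists_congr fun k => and_congr_left' (S k).comm')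
  · rcases (hu x y _).1 (le_max_left _ (u y z)) with h | ⟨k, hk, h⟩
    · exact (hu _ _ _).2 (Or.inl h)
    rcases (hu y z _).1 (le_max_right (u x y) _) with h' | ⟨l, hl, h'⟩
    · exact (hu _ _ _).2 (Or.inl h')
    refine (hu _ _ _).2 (Or.inr ⟨max k l,
      (S _).trans (hS (le_max_left k l) hk) (hS (le_max_right k l) hl), ?_⟩)
    rcases max_choice k l with hkl | hkl <;> rwa [hkl]

/-- Composing the first `k` of a sequence of self-maps. -/
def iterComp {X : Type*} (σ : ℕ → X → X) : ℕ → X → X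
  | 0 => id
  | k + 1 => σ k ∘ iterComp σ k

/-- If `σ k` picks representatives of a partition with diameters at most `δ k`, and `δ` grows
geometrically, then there is a dominating ultrametric that is small on the pairs which are padded
in one of these partitions. -/
theorem exists_isDominatingUltrametric_of_representatives {X : Type*} [MetricSpace X] [Finite X]
    (σ : ℕ → X → X) (δ : ℕ → ℝ) (t : ℝ) (ht : 0 < t) (hδ : ∀ k, 0 ≤ δ k)
    (hgrow : ∀ k, (1 + t) * δ k ≤ t * δ (k + 1))
    (hdiam : ∀ k p q, σ k p = σ k q → dist p q ≤ δ k) (hmove : ∀ k p, dist p (σ k p) ≤ δ k) :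
    ∃ u : X → X → ℝ, IsDominatingUltrametric u ∧
      ∀ k r x y, (∀ p ∈ Metric.closedBall x r, ∀ q ∈ Metric.closedBall x r, σ k p = σ k q) →
        dist x y + t * δ k ≤ r → u x y ≤ (1 + 2 * t) * δ k := by
  have hdrift : ∀ k x, dist x (iterComp σ k x) ≤ t * δ k := by
    intro k
    induction k with
    | zero => intro x; simpa [iterComp] using mul_nonneg ht.le (hδ 0)
    | succ k ih =>
      intro x
      have h₁ := dist_triangle x (iterComp σ k x) (iterComp σ (k + 1) x)
      have h₂ : dist (iterComp σ k x) (iterComp σ (k + 1) x) ≤ δ k := hmove k _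
      linarith [ih x, hgrow k]
  have hmono : Monotone δ := monotone_nat_of_le_succ fun k => by
    have := hgrow k
    have := hδ k
    exact le_of_mul_le_mul_left (by linarith) ht
  let D : ℕ → ℝ := fun k => Nat.casesOn k 0 fun k => (1 + 2 * t) * δ k
  obtain ⟨u, hu, hle⟩ := exists_isDominatingUltrametric_of_monotone_setoid
    (fun k => Setoid.ker (iterComp σ k))
    (monotone_nat_of_le_succ fun k x y hxy => congrArg (σ k) hxy) D
    (monotone_nat_of_le_succ fun k => by
      cases k with
      | zero => exact mul_nonneg (by linarith) (hδ 0)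
      | succ k => exact mul_le_mul_of_nonneg_left (hmono k.le_succ) (by linarith))
    rfl
    (fun k x y hxy => by
      cases k with
      | zero =>
        have hxy' : x = y := hxy
        simp [hxy', D]
      | succ k =>
        have h₁ := hdiam k _ _ hxy
        have h₂ := dist_triangle4 x (iterComp σ k x) (iterComp σ k y) y
        have h₃ := hdrift k y
        rw [dist_comm] at h₃
        change _ ≤ (1 + 2 * t) * δ k
        linarith [hdrift k x])
  refine ⟨u, hu, fun k r x y hpad hr => hle (k + 1) x y (hpad _ ?_ _ ?_)⟩
  · rw [Metric.mem_closedBall, dist_comm]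
    linarith [hdrift k x, dist_nonneg (x := x) (y := y)]
  · rw [Metric.mem_closedBall, dist_comm]
    linarith [hdrift k y, dist_triangle x y (iterComp σ k y)]

/-- A map choosing a representative in each cluster of a partition of bounded diameter. -/
theorem exists_representatives_of_isPartition {X : Type*} [MetricSpace X] [Finite X]
    {P : Set (Set X)} (hP : Setoid.IsPartition P) {Δ : ℝ} (hΔ : ∀ Y ∈ P, Metric.diam Y ≤ Δ) :
    ∃ σ : X → X, (∀ p q, σ p = σ q → dist p q ≤ Δ) ∧ (∀ p, dist p (σ p) ≤ Δ) ∧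
      ∀ Y ∈ P, ∀ p ∈ Y, ∀ q ∈ Y, σ p = σ q := by
  choose block hblock huniq using fun p => (hP.2 p)
  have hdist : ∀ p q, block p = block q → dist p q ≤ Δ := fun p q h =>
    (Metric.dist_le_diam_of_mem (Set.toFinite _).isBounded (hblock p).2
      (h ▸ (hblock q).2)).trans (hΔ _ (hblock p).1)
  have hout : ∀ p, block (Quotient.mk (Setoid.ker block) p).out = block p := fun p =>
    Quotient.mk_out (s := Setoid.ker block) p
  refine ⟨fun p => (Quotient.mk (Setoid.ker block) p).out, fun p q h => hdist _ _ ?_,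
    fun p => hdist _ _ (hout p).symm, fun Y hY p hp q hq => ?_⟩
  · rw [← hout p, ← hout q]
    exact congrArg block h
  · have h : Quotient.mk (Setoid.ker block) p = Quotient.mk (Setoid.ker block) q :=
      Quotient.sound ((huniq p Y ⟨hY, hp⟩).symm.trans (huniq q Y ⟨hY, hq⟩))
    simp only [h]

/-- The number of geometric scales of ratio `1 + ε / 8` that fit between `1` and
`1 + 8 * ρ / ε` is `O(ε⁻¹ log (ρ / ε))`. -/
theorem exists_pow_ge_and_le_log {ρ ε : ℝ} (hρ : 1 ≤ ρ) (hε : 0 < ε) (hε' : ε < 1 / 2) :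
    ∃ N : ℕ, 1 + 8 * ρ / ε ≤ (1 + ε / 8) ^ N ∧ (N : ℝ) ≤ 81 / ε * Real.log (ρ / ε) := by
  have h2 : 2 ≤ ρ / ε := by rw [le_div_iff₀ hε]; linarith
  have hpos : 0 < ρ / ε := by linarith
  have hl2 : Real.log 2 ≤ Real.log (ρ / ε) := Real.log_le_log (by norm_num) h2
  have hlog2 : (1 / 2 : ℝ) ≤ Real.log 2 := by linarith [Real.log_two_gt_d9]
  have hbase : ε / 16 ≤ Real.log (1 + ε / 8) := by
    have h := Real.one_sub_inv_le_log_of_pos (x := 1 + ε / 8) (by linarith)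
    refine le_trans ?_ h
    have : (1 + ε / 8)⁻¹ ≤ 1 - ε / 16 := by
      rw [inv_le_iff_one_le_mul₀ (by linarith)]
      nlinarith
    linarith
  have hb : 0 < Real.log (1 + ε / 8) := by linarith
  have htarget : Real.log (1 + 8 * ρ / ε) ≤ 5 * Real.log (ρ / ε) := by
    have h₁ : 1 + 8 * ρ / ε ≤ 2 ^ 4 * (ρ / ε) := by
      rw [mul_div_assoc]; linarith
    have h₂ := Real.log_le_log (by rw [mul_div_assoc]; linarith) h₁
    rw [Real.log_mul (by norm_num) hpos.ne', Real.log_pow] at h₂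
    push_cast at h₂
    linarith
  refine ⟨⌈Real.log (1 + 8 * ρ / ε) / Real.log (1 + ε / 8)⌉₊, ?_, ?_⟩
  · have hp : 0 < 1 + 8 * ρ / ε := by rw [mul_div_assoc]; linarith
    rw [← Real.log_le_log_iff hp (by positivity), Real.log_pow, ← div_le_iff₀ hb]
    exact Nat.le_ceil _
  · have h0 : 0 ≤ Real.log (1 + 8 * ρ / ε) :=
      Real.log_nonneg (by rw [mul_div_assoc]; linarith)
    have h₁ := Nat.ceil_lt_add_one (div_nonneg h0 hb.le)
    have h₂ : Real.log (1 + 8 * ρ / ε) / Real.log (1 + ε / 8) ≤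
        80 / ε * Real.log (ρ / ε) := by
      rw [div_le_iff₀ hb]
      calc Real.log (1 + 8 * ρ / ε) ≤ 80 / ε * Real.log (ρ / ε) * (ε / 16) := by
            refine htarget.trans_eq ?_
            field_simp
            linarith
        _ ≤ _ := mul_le_mul_of_nonneg_left hbase (mul_nonneg (by positivity) (by linarith))
    have h₃ : 1 ≤ 1 / ε * Real.log (ρ / ε) := by
      rw [one_div_mul_eq_div, le_div_iff₀ hε]
      linarith
    have h₄ : 81 / ε * Real.log (ρ / ε) =
        80 / ε * Real.log (ρ / ε) + 1 / ε * Real.log (ρ / ε) := by ring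
    linarith

/-- In a finite metric space the positive distances are bounded away from zero. -/
theorem exists_pos_le_dist_of_ne (X : Type*) [MetricSpace X] [Finite X] :
    ∃ a : ℝ, 0 < a ∧ ∀ x y : X, x ≠ y → a ≤ dist x y := by
  rcases isEmpty_or_nonempty {p : X × X // p.1 ≠ p.2} with h | h
  · exact ⟨1, one_pos, fun x y hxy => (h.false ⟨(x, y), hxy⟩).elim⟩
  · obtain ⟨p, hp⟩ := Finite.exists_min fun p : {p : X × X // p.1 ≠ p.2} => dist p.1.1 p.1.2
    exact ⟨_, dist_pos.2 p.2, fun x y hxy => hp ⟨(x, y), hxy⟩⟩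

/-- **Ultrametric cover from a padded partition cover scheme.**  There is a universal constant
`C > 0` such that: if a finite metric space `X` admits a `(τ, ρ)`-padded partition cover scheme
(for every `Δ > 0`, at most `τ` partitions into clusters of diameter at most `Δ` such that every
closed ball of radius `Δ/ρ` is contained in some cluster of some partition), then for every
`ε ∈ (0, 1/2)` there are at most `C·(τ/ε)·log(ρ/ε)` dominating ultrametrics over `X` such that
every pair `x, y` satisfies `min_j u_j(x,y) ≤ ρ·(1+ε)·dist x y`. -/
theorem ultrametric_cover_from_padded_partition_cover :
    ∃ C : ℝ, 0 < C ∧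
      ∀ (X : Type) [MetricSpace X] [Fintype X] (τ ρ : ℝ), 1 ≤ τ → 1 ≤ ρ →
        (∀ Δ : ℝ, 0 < Δ →
          ∃ (s : ℕ) (P : Fin s → Set (Set X)),
            (s : ℝ) ≤ τ ∧
            (∀ i, Setoid.IsPartition (P i)) ∧
            (∀ i, ∀ Y ∈ P i, Metric.diam Y ≤ Δ) ∧
            (∀ x : X, ∃ i, ∃ Y ∈ P i, Metric.closedBall x (Δ / ρ) ⊆ Y)) →
        ∀ ε : ℝ, 0 < ε → ε < 1 / 2 →
          ∃ (m : ℕ) (u : Fin m → X → X → ℝ),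
            (m : ℝ) ≤ C * (τ / ε) * Real.log (ρ / ε) ∧
            (∀ j, IsDominatingUltrametric (u j)) ∧
            ∀ x y : X, ∃ j : Fin m, u j x y ≤ ρ * (1 + ε) * dist x y := by
  refine ⟨81, by norm_num, fun X _ _ τ ρ hτ hρ hscheme ε hε hε' => ?_⟩
  have hrep : ∀ Δ : ℝ, 0 < Δ → ∃ σ : Fin ⌊τ⌋₊ → X → X,
      (∀ i p q, σ i p = σ i q → dist p q ≤ Δ) ∧ (∀ i p, dist p (σ i p) ≤ Δ) ∧
      ∀ x, ∃ i, ∀ p ∈ Metric.closedBall x (Δ / ρ), ∀ q ∈ Metric.closedBall x (Δ / ρ),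
        σ i p = σ i q := by
    intro Δ hΔ
    obtain ⟨s, P, hs, hP, hdiam, hpad⟩ := hscheme Δ hΔ
    choose σ h₁ h₂ h₃ using fun i => exists_representatives_of_isPartition (hP i) (hdiam i)
    refine ⟨fun i => if h : (i : ℕ) < s then σ ⟨i, h⟩ else id, fun i p q => ?_, fun i p => ?_,
      fun x => ?_⟩
    · dsimp only
      split_ifs with h
      · exact h₁ _ p q
      · rintro (rfl : p = q)
        simpa using hΔ.le
    · dsimp only
      split_ifs with h
      · exact h₂ _ p
      · simpa using hΔ.le
    · obtain ⟨i, Y, hY, hsub⟩ := hpad x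
      refine ⟨⟨i, i.2.trans_le (Nat.le_floor hs)⟩, fun p hp q hq => ?_⟩
      simpa using h₃ i Y hY p (hsub hp) q (hsub hq)
  obtain ⟨N, hN, hNle⟩ := exists_pow_ge_and_le_log hρ hε hε'
  obtain ⟨a, ha, hadist⟩ := exists_pos_le_dist_of_ne X
  have hρ0 : 0 < ρ := by linarith
  have hN0 : 0 < N := by
    rcases Nat.eq_zero_or_pos N with rfl | h
    · have : 0 < 8 * ρ / ε := by positivity
      rw [pow_zero] at hN
      linarith
    · exact h
  set e : ℝ := ε / 8 with he
  have he0 : 0 < e := by positivity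
  have he1 : e < 1 / 16 := by linarith
  set t : ℝ := e / ρ with ht
  have ht0 : 0 < t := by positivity
  have hte : t ≤ e := div_le_self he0.le hρ
  let scale : ℕ → ℝ := fun n => a * (1 + e) ^ n
  have hscale : ∀ n, 0 < scale n := fun n => by positivity
  choose σ hdiam hmove hpad using fun n => hrep (scale n) (hscale n)
  have hratio : 1 + t ≤ t * (1 + e) ^ N := by
    have h : t * (1 + 8 * ρ / ε) = 1 + t := by
      rw [ht, he]
      field_simp
      ring
    rw [← h]
    exact mul_le_mul_of_nonneg_left hN ht0.le
  choose u hu hule using fun (c : Fin N) (i : Fin ⌊τ⌋₊) =>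
    exists_isDominatingUltrametric_of_representatives
      (fun k => σ (c + N * k) i) (fun k => scale (c + N * k)) t ht0 (fun k => (hscale _).le)
      (fun k => by
        have h : t * scale (c + N * (k + 1)) = t * (1 + e) ^ N * scale (c + N * k) := by
          simp only [scale]
          ring
        rw [h]
        exact mul_le_mul_of_nonneg_right hratio (hscale _).le)
      (fun k => hdiam _ i) (fun k => hmove _ i)
  refine ⟨N * ⌊τ⌋₊, fun j => u (finProdFinEquiv.symm j).1 (finProdFinEquiv.symm j).2, ?_,
    fun j => hu _ _, fun x y => ?_⟩
  · have hfl : (⌊τ⌋₊ : ℝ) ≤ τ := Nat.floor_le (by linarith)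
    push_cast
    calc (N : ℝ) * ⌊τ⌋₊ ≤ (81 / ε * Real.log (ρ / ε)) * τ :=
          mul_le_mul hNle hfl (Nat.cast_nonneg _) ((Nat.cast_nonneg _).trans hNle)
      _ = _ := by ring
  suffices h : ∃ c i, u c i x y ≤ ρ * (1 + ε) * dist x y by
    obtain ⟨c, i, h⟩ := h
    exact ⟨finProdFinEquiv (c, i), by simpa using h⟩
  rcases eq_or_ne x y with rfl | hxy
  · obtain ⟨i, -⟩ := hpad 0 x
    exact ⟨⟨0, hN0⟩, i, by simp [(hu ⟨0, hN0⟩ i).1 x]⟩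
  have hd : a ≤ dist x y := hadist x y hxy
  have hd0 : 0 < dist x y := ha.trans_le hd
  have hden : 0 < a * (1 - e) := mul_pos ha (by linarith)
  obtain ⟨n, hn₁, hn₂⟩ := exists_nat_pow_near (x := ρ * dist x y / (a * (1 - e))) (y := 1 + e)
    (by
      rw [le_div_iff₀ hden]
      nlinarith [mul_nonneg (sub_nonneg.2 hρ) hd0.le, mul_pos ha he0]) (by linarith)
  rw [le_div_iff₀ hden] at hn₁
  rw [div_lt_iff₀ hden] at hn₂
  have hlow : ρ * dist x y ≤ (1 - e) * scale (n + 1) := by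
    simp only [scale]
    linarith
  have hupp : (1 - e) * scale (n + 1) ≤ (1 + e) * (ρ * dist x y) := by
    have := mul_le_mul_of_nonneg_left hn₁ (by linarith : (0 : ℝ) ≤ 1 + e)
    calc (1 - e) * scale (n + 1) = (1 + e) * ((1 + e) ^ n * (a * (1 - e))) := by
          simp only [scale]
          ring
      _ ≤ _ := this
  obtain ⟨i, hi⟩ := hpad (n + 1) x
  have hmod : (n + 1) % N + N * ((n + 1) / N) = n + 1 := Nat.mod_add_div _ _
  have hfinal := hule ⟨(n + 1) % N, Nat.mod_lt _ hN0⟩ i ((n + 1) / N) (scale (n + 1) / ρ) x y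
  simp only [hmod] at hfinal
  refine ⟨_, i, (hfinal hi ?_).trans ?_⟩
  · have h : (dist x y + t * scale (n + 1)) * ρ = ρ * dist x y + e * scale (n + 1) := by
      rw [ht]
      field_simp
    rw [le_div_iff₀ hρ0, h]
    linarith
  · have hS := hscale (n + 1)
    have hw : 0 < ρ * dist x y := by positivity
    have h₁ : (1 + 2 * t) * scale (n + 1) ≤ (1 + 2 * e) * scale (n + 1) :=
      mul_le_mul_of_nonneg_right (by linarith) hS.le
    have h₂ := mul_le_mul_of_nonneg_left hupp (by linarith : (0 : ℝ) ≤ 1 + 2 * e)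
    have h₃ : (1 + 2 * e) * (1 + e) ≤ (1 - e) * (1 + ε) := by
      rw [show ε = 8 * e by rw [he]; ring]
      nlinarith
    have h₄ := mul_le_mul_of_nonneg_right h₃ hw.le
    refine h₁.trans (le_of_mul_le_mul_left ?_ (by linarith : 0 < 1 - e))
    linarith
end

section
/- Let (X,d_X) be a finite metric space admitting a (τ,ρ)-LSO with ρ < 1/4. Then for every subset T ⊆ X and every real L > 0 there exists a set E of unordered pairs of points of T with total weight ∑_{{u,v} ∈ E} d_X(u,v) ≤ 2·τ·|T|·L, such that for all u,v ∈ T with L ≤ d_X(u,v) < 2L there is a finite sequence u = z_0, z_1, …, z_k = v of points of T with each consecutive pair {z_i, z_{i+1}} ∈ E and ∑_{i<k} d_X(z_i, z_{i+1}) ≤ (1 + 8ρ)·d_X(u,v). (That is, X admits a (1+8ρ)-spanner oracle of weak sparsity at most 2τ.) -/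
/-- The weight of an unordered pair of points: the distance between its endpoints. -/
noncomputable def pairWeight {X : Type*} [MetricSpace X] : Sym2 X → ℝ :=
  Sym2.lift ⟨fun x y => dist x y, fun _ _ => dist_comm _ _⟩

/-- A path through points of `T` with edges in `E`, from `u` to `v` and of total length `ℓ`. -/
inductive EdgePath {X : Type*} [MetricSpace X] (T : Finset X) (E : Finset (Sym2 X)) :
    X → X → ℝ → Prop
  | nil {u : X} : u ∈ T → EdgePath T E u u 0
  | cons {u v w : X} {ℓ : ℝ} : u ∈ T → s(u, v) ∈ E → EdgePath T E v w ℓ →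
      EdgePath T E u w (dist u v + ℓ)

namespace EdgePath

variable {X : Type*} [MetricSpace X] {T : Finset X} {E : Finset (Sym2 X)} {u v w : X} {ℓ ℓ' : ℝ}

theorem trans (h : EdgePath T E u v ℓ) (h' : EdgePath T E v w ℓ') :
    EdgePath T E u w (ℓ + ℓ') := by
  induction h with
  | nil _ => simpa using h'
  | cons hu he _ ih => rw [add_assoc]; exact cons hu he (ih h')

theorem mem_left (h : EdgePath T E u v ℓ) : u ∈ T := by
  cases h <;> assumption

theorem symm (h : EdgePath T E u v ℓ) : EdgePath T E v u ℓ := by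
  induction h with
  | nil hu => exact nil hu
  | @cons u v w ℓ hu he h ih =>
    have hvu : EdgePath T E v u (dist v u + 0) := cons h.mem_left (Sym2.eq_swap ▸ he) (nil hu)
    have := ih.trans hvu
    rwa [add_zero, dist_comm, add_comm] at this

theorem exists_fin (h : EdgePath T E u v ℓ) :
    ∃ (k : ℕ) (z : Fin (k + 1) → X),
      z 0 = u ∧ z (Fin.last k) = v ∧
      (∀ i, z i ∈ T) ∧
      (∀ i : Fin k, s(z i.castSucc, z i.succ) ∈ E) ∧
      (∑ i : Fin k, dist (z i.castSucc) (z i.succ)) = ℓ := by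
  induction h with
  | @nil u hu => exact ⟨0, fun _ => u, rfl, rfl, fun _ => hu, fun i => i.elim0, by simp⟩
  | @cons u v w ℓ hu he _ ih =>
    obtain ⟨k, z, h0, hl, hT, hE, hs⟩ := ih
    refine ⟨k + 1, Fin.cons u z, rfl, ?_, ?_, ?_, ?_⟩
    · rw [← Fin.succ_last, Fin.cons_succ, hl]
    · exact Fin.cases hu hT
    · refine Fin.cases ?_ fun i => ?_
      · simpa [h0] using he
      · rw [← Fin.succ_castSucc, Fin.cons_succ, Fin.cons_succ]
        exact hE i
    · rw [Fin.sum_univ_succ]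
      simp only [← Fin.succ_castSucc, Fin.cons_succ, hs]
      simp [h0]

end EdgePath

/-- The gap between `t j` and `t (j + 1)` in the sequence `t` separates two terms at distance
less than `2 * L`, the terms in between being close to the endpoint on their side of the gap. -/
def IsSeparatingGap {X : Type*} [MetricSpace X] (t : ℕ → X) (n : ℕ) (ρ L : ℝ) (j : ℕ) : Prop :=
  ∃ p q, p ≤ j ∧ j + 1 ≤ q ∧ q < n ∧ dist (t p) (t q) < 2 * L ∧
    (∀ k, p ≤ k → k ≤ j → dist (t p) (t k) ≤ ρ * dist (t p) (t q)) ∧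
    ∀ k, j + 1 ≤ k → k ≤ q → dist (t q) (t k) ≤ ρ * dist (t p) (t q)

/-- A gap of length more than `2 * L` that is separating has a neighbouring gap of length at most
`L` on every side that contributes to its excess length. -/
theorem IsSeparatingGap.dist_le {X : Type*} [MetricSpace X] {t : ℕ → X} {n : ℕ} {ρ L : ℝ} {j : ℕ}
    (hρ : ρ < 1 / 4) (h : IsSeparatingGap t n ρ L j) {S : ℕ → ℝ}
    (hS : ∀ i, S (i + 1) = if dist (t i) (t (i + 1)) ≤ L then 1 else 0) (hS0 : S 0 = 0)
    (hL : 0 < L) :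
    dist (t j) (t (j + 1)) ≤
      2 * L + L / 2 * (S j - S (j + 1)) + L / 2 * (S (j + 2) - S (j + 1)) := by
  obtain ⟨p, q, hpj, hjq, -, hD, hp, hq⟩ := h
  have hρD : ρ * dist (t p) (t q) ≤ L / 2 := by
    nlinarith [dist_nonneg (x := t p) (y := t q)]
  have hS_nonneg : ∀ i, 0 ≤ S i := by
    rintro (_ | i)
    · rw [hS0]
    · rw [hS]; split_ifs <;> norm_num
  have hleft : dist (t p) (t j) ≤ L / 2 * S j := by
    rcases hpj.eq_or_lt with rfl | hlt
    · rw [dist_self]; exact mul_nonneg (by linarith) (hS_nonneg _)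
    · obtain ⟨i, rfl⟩ : ∃ i, j = i + 1 := ⟨j - 1, by omega⟩
      have h1 := hp i (by omega) (by omega)
      have h2 := hp (i + 1) hpj le_rfl
      rw [hS, if_pos (by linarith [dist_triangle_left (t i) (t (i + 1)) (t p)])]
      linarith
  have hright : dist (t q) (t (j + 1)) ≤ L / 2 * S (j + 2) := by
    rcases hjq.eq_or_lt with rfl | hlt
    · rw [dist_self]; exact mul_nonneg (by linarith) (hS_nonneg _)
    · have h1 := hq (j + 1) le_rfl hjq
      have h2 := hq (j + 2) (by omega) hlt
      rw [hS, if_pos (by linarith [dist_triangle_left (t (j + 1)) (t (j + 2)) (t q)])]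
      linarith
  by_cases hshort : dist (t j) (t (j + 1)) ≤ L
  · rw [hS j, if_pos hshort]
    nlinarith [hS_nonneg j, hS_nonneg (j + 2)]
  · rw [hS j, if_neg hshort]
    have := dist_triangle4 (t j) (t p) (t q) (t (j + 1))
    rw [dist_comm (t j) (t p)] at this
    linarith

open Classical in
theorem sum_isSeparatingGap_le {X : Type*} [MetricSpace X] (t : ℕ → X) (n m : ℕ) {ρ L : ℝ}
    (hρ : ρ < 1 / 4) (hL : 0 < L) :
    ∑ j ∈ (Finset.range m).filter (IsSeparatingGap t n ρ L), dist (t j) (t (j + 1)) ≤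
      2 * (m + 1) * L := by
  let S : ℕ → ℝ := fun i => Nat.casesOn i 0 fun i => if dist (t i) (t (i + 1)) ≤ L then 1 else 0
  have hS : ∀ i, S (i + 1) = if dist (t i) (t (i + 1)) ≤ L then 1 else 0 := fun _ => rfl
  have hS01 : ∀ i, 0 ≤ S i ∧ S i ≤ 1 := by
    rintro (_ | i)
    · exact ⟨le_rfl, zero_le_one⟩
    · rw [hS]; split_ifs <;> norm_num
  calc _ ≤ ∑ j ∈ Finset.range m,
        (2 * L + L / 2 * (S j - S (j + 1)) + L / 2 * (S (j + 1 + 1) - S (j + 1))) := by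
        rw [Finset.sum_filter]
        refine Finset.sum_le_sum fun j _ => ?_
        split_ifs with h
        · exact h.dist_le hρ hS rfl hL
        · rw [hS j]
          split_ifs <;> nlinarith [hS01 j, hS01 (j + 1 + 1)]
    _ = 2 * m * L + L / 2 * (S 0 - S m) + L / 2 * (S (m + 1) - S 1) := by
        rw [Finset.sum_add_distrib, Finset.sum_add_distrib, Finset.sum_const,
          ← Finset.mul_sum, ← Finset.mul_sum,
          Finset.sum_range_sub' S, Finset.sum_range_sub (fun j => S (j + 1))]
        simp
        ring
    _ ≤ _ := by
        have h0 : S 0 = 0 := rfl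
        nlinarith [hS01 m, hS01 (m + 1), hS01 1]

theorem Finset.exists_enum_of_isLinearOrder {X : Type*} (r : X → X → Prop) (hr : IsLinearOrder X r)
    (T : Finset X) (hT : T.Nonempty) :
    ∃ t : ℕ → X, (∀ j < T.card, t j ∈ T) ∧ (∀ x ∈ T, ∃ j < T.card, t j = x) ∧
      ∀ j k, j ≤ k → k < T.card → r (t j) (t k) := by
  classical
  obtain ⟨x₀, -⟩ := hT
  let : LinearOrder X :=
    { le := r
      le_refl := refl_of r
      le_trans := fun _ _ _ => trans_of r
      le_antisymm := fun _ _ => antisymm_of r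
      le_total := total_of r
      toDecidableLE := Classical.decRel r }
  refine ⟨fun j => if h : j < T.card then T.orderEmbOfFin rfl ⟨j, h⟩ else x₀, ?_, ?_, ?_⟩
  · intro j hj
    simp only [hj, dite_true]
    exact T.orderEmbOfFin_mem rfl _
  · intro x hx
    have : x ∈ Set.range (T.orderEmbOfFin rfl) := by rwa [T.range_orderEmbOfFin rfl]
    obtain ⟨j, rfl⟩ := this
    exact ⟨j, j.2, by simp⟩
  · intro j k hjk hk
    simp only [hk, hjk.trans_lt hk, dite_true]
    exact (T.orderEmbOfFin rfl).monotone hjk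

theorem Finset.sum_biUnion_le_of_nonneg {ι α : Type*} [Fintype ι] [DecidableEq α]
    (E : ι → Finset α) {f : α → ℝ} (hf : ∀ a, 0 ≤ f a) :
    ∑ a ∈ Finset.univ.biUnion E, f a ≤ ∑ i, ∑ a ∈ E i, f a := by
  have h : Finset.univ.biUnion E = (Finset.univ.sigma E).image fun a => a.2 := by
    ext a
    simp
  rw [h, ← Finset.sum_sigma Finset.univ E fun a => f a.2]
  exact Finset.sum_image_le_of_nonneg fun a _ => hf a

/-- In an enumeration of a finite set along a linear order `r`, the locality-sensitive property of
`r` for two points of the set is witnessed at a gap between consecutive points. -/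
theorem exists_gap_of_cut {X : Type*} [MetricSpace X] {r : X → X → Prop} (hr : IsLinearOrder X r)
    {t : ℕ → X} {n p q : ℕ} {ρ : ℝ} (hρ : ρ < 1 / 4)
    (ht : ∀ j k, j ≤ k → k < n → r (t j) (t k)) (hp : p < n) (hq : q < n) (hpq : t p ≠ t q) {c : X}
    (hxc : r (t p) c) (hcy : r c (t q))
    (hleft : ∀ z, r (t p) z → r z c → dist (t p) z ≤ ρ * dist (t p) (t q))
    (hright : ∀ z, ¬ r z c → r z (t q) → dist (t q) z ≤ ρ * dist (t p) (t q)) :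
    ∃ j, p ≤ j ∧ j + 1 ≤ q ∧
      (∀ k, p ≤ k → k ≤ j → dist (t p) (t k) ≤ ρ * dist (t p) (t q)) ∧
      ∀ k, j + 1 ≤ k → k ≤ q → dist (t q) (t k) ≤ ρ * dist (t p) (t q) := by
  classical
  have hD : 0 < dist (t p) (t q) := dist_pos.2 hpq
  have hyc : ¬ r (t q) c := fun h => by
    nlinarith [hleft (t q) (trans_of r hxc hcy) h]
  have hex : ∃ k, k ≤ q ∧ ¬ r (t k) c := ⟨q, le_rfl, hyc⟩
  obtain ⟨hkq, hk⟩ := Nat.find_spec hex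
  have hmin : ∀ i < Nat.find hex, r (t i) c := fun i hi => by
    by_contra h
    exact Nat.find_min hex hi ⟨hi.le.trans hkq, h⟩
  have hpk : p < Nat.find hex := by
    by_contra! h
    exact hk (trans_of r (ht _ _ h hp) hxc)
  obtain ⟨j, hj⟩ : ∃ j, Nat.find hex = j + 1 := ⟨Nat.find hex - 1, by omega⟩
  rw [hj] at hkq hk hmin hpk
  refine ⟨j, by omega, hkq, fun k hpk hkj => ?_, fun k hjk hkq => ?_⟩
  · exact hleft _ (ht _ _ hpk (by omega)) (hmin k (by omega))
  · exact hright _ (fun h => hk (trans_of r (ht _ _ hjk (by omega)) h)) (ht _ _ hkq hq)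

/-- One step of the induction on distances: a pair of points joined through the two endpoints of an
edge that are close to them. -/
theorem EdgePath.exists_of_edge {X : Type*} [MetricSpace X] {T : Finset X} {E : Finset (Sym2 X)}
    {ρ : ℝ} (hρ : ρ < 1 / 4) {x y a b : X} (hx : x ∈ T) (hy : y ∈ T) (ha : a ∈ T) (hb : b ∈ T)
    (hxy : x ≠ y) (hab : s(a, b) ∈ E)
    (hxa : dist x a ≤ ρ * dist x y) (hyb : dist y b ≤ ρ * dist x y)
    (ih : ∀ u ∈ T, ∀ v ∈ T, dist u v < dist x y →
      ∃ ℓ ≤ (1 + 8 * ρ) * dist u v, EdgePath T E u v ℓ) :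
    ∃ ℓ ≤ (1 + 8 * ρ) * dist x y, EdgePath T E x y ℓ := by
  have hD : 0 < dist x y := dist_pos.2 hxy
  have hρ0 : 0 ≤ ρ := nonneg_of_mul_nonneg_left (dist_nonneg.trans hxa) hD
  obtain ⟨ℓ₁, h₁, P₁⟩ := ih x hx a ha (by nlinarith)
  obtain ⟨ℓ₂, h₂, P₂⟩ := ih y hy b hb (by nlinarith)
  refine ⟨_, ?_, P₁.trans (.cons ha hab P₂.symm)⟩
  have htri := dist_triangle4 a x y b
  rw [dist_comm a x] at htri
  have h₁' : (1 + 8 * ρ) * dist x a ≤ (1 + 8 * ρ) * (ρ * dist x y) := by gcongr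
  have h₂' : (1 + 8 * ρ) * dist y b ≤ (1 + 8 * ρ) * (ρ * dist x y) := by gcongr
  have h₃ : 0 ≤ ρ * dist x y * (1 - 4 * ρ) :=
    mul_nonneg (mul_nonneg hρ0 hD.le) (by linarith)
  nlinarith

/-- **Spanner oracle from an LSO.**  Let `X` be a finite metric space admitting a
`(τ, ρ)`-LSO with `ρ < 1/4`.  Then for every `T ⊆ X` and `L > 0` there is a set `E` of
unordered pairs of points of `T` of total weight at most `2·τ·|T|·L` such that every pair
`u, v ∈ T` with `L ≤ dist u v < 2L` is connected by an `E`-path of total length at most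
`(1 + 8ρ)·dist u v`. -/
theorem spanner_oracle_from_LSO :
    ∀ (X : Type) [MetricSpace X] [Fintype X] (τ ρ : ℝ), ρ < 1 / 4 →
      IsLSO (fun x y : X => dist x y) τ ρ →
      ∀ (T : Finset X) (L : ℝ), 0 < L →
        ∃ E : Finset (Sym2 X),
          (∀ e ∈ E, ∀ x ∈ e, x ∈ T) ∧
          (∑ e ∈ E, pairWeight e) ≤ 2 * τ * T.card * L ∧
          ∀ u ∈ T, ∀ v ∈ T, L ≤ dist u v → dist u v < 2 * L →
            ∃ (k : ℕ) (z : Fin (k + 1) → X),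
              z 0 = u ∧ z (Fin.last k) = v ∧
              (∀ i, z i ∈ T) ∧
              (∀ i : Fin k, s(z i.castSucc, z i.succ) ∈ E) ∧
              (∑ i : Fin k, dist (z i.castSucc) (z i.succ)) ≤ (1 + 8 * ρ) * dist u v := by
  classical
  intro X _ _ τ ρ hρ ⟨m, σ, hm, hσ, hlso⟩ T L hL
  rcases T.eq_empty_or_nonempty with rfl | hT
  · exact ⟨∅, by simp⟩
  choose t htT htsurj htmono using fun i => T.exists_enum_of_isLinearOrder (σ i) (hσ i) hT
  have hcard : 0 < T.card := hT.card_pos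
  let E : Fin m → Finset (Sym2 X) := fun i =>
    ((Finset.range (T.card - 1)).filter (IsSeparatingGap (t i) T.card ρ L)).image
      fun j => s(t i j, t i (j + 1))
  have hw : ∀ e : Sym2 X, 0 ≤ pairWeight e := Sym2.ind fun _ _ => dist_nonneg
  have hEw : ∀ i, ∑ e ∈ E i, pairWeight e ≤ 2 * T.card * L := fun i => by
    refine (Finset.sum_image_le_of_nonneg fun e _ => hw e).trans ?_
    refine (sum_isSeparatingGap_le (t i) T.card (T.card - 1) hρ hL).trans_eq ?_
    rw [Nat.cast_sub hcard]
    simp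
  refine ⟨Finset.univ.biUnion E, ?_, ?_, ?_⟩
  · intro e he x hx
    obtain ⟨i, -, he⟩ := Finset.mem_biUnion.1 he
    obtain ⟨j, hj, rfl⟩ := Finset.mem_image.1 he
    have hj := Finset.mem_range.1 (Finset.mem_filter.1 hj).1
    rcases Sym2.mem_iff.1 hx with rfl | rfl <;> exact htT i _ (by omega)
  · calc _ ≤ ∑ i, ∑ e ∈ E i, pairWeight e := Finset.sum_biUnion_le_of_nonneg E hw
      _ ≤ ∑ _i : Fin m, 2 * (T.card : ℝ) * L := Finset.sum_le_sum fun i _ => hEw i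
      _ = m * (2 * T.card * L) := by simp
      _ ≤ τ * (2 * T.card * L) := by gcongr
      _ = _ := by ring
  · have hstep : ∀ i, ∀ x ∈ T, ∀ y ∈ T, x ≠ y → dist x y < 2 * L →
        (∃ c, σ i x c ∧ σ i c y ∧
          (∀ z, σ i x z → σ i z c → dist x z ≤ ρ * dist x y) ∧
          ∀ z, ¬ σ i z c → σ i z y → dist y z ≤ ρ * dist x y) →
        (∀ u ∈ T, ∀ v ∈ T, dist u v < dist x y →
          ∃ ℓ ≤ (1 + 8 * ρ) * dist u v, EdgePath T (Finset.univ.biUnion E) u v ℓ) →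
        ∃ ℓ ≤ (1 + 8 * ρ) * dist x y, EdgePath T (Finset.univ.biUnion E) x y ℓ := by
      rintro i x hx y hy hxy hlt ⟨c, hxc, hcy, hl, hr⟩ ih
      obtain ⟨p, hp, rfl⟩ := htsurj i x hx
      obtain ⟨q, hq, rfl⟩ := htsurj i y hy
      obtain ⟨j, hpj, hjq, hpj', hqj'⟩ :=
        exists_gap_of_cut (hσ i) hρ (htmono i) hp hq hxy hxc hcy hl hr
      refine EdgePath.exists_of_edge hρ hx hy (htT i j (by omega)) (htT i (j + 1) (by omega)) hxy
        ?_ (hpj' j hpj le_rfl) (hqj' (j + 1) le_rfl hjq) ih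
      refine Finset.mem_biUnion.2 ⟨i, Finset.mem_univ _, Finset.mem_image.2 ⟨j, ?_, rfl⟩⟩
      exact Finset.mem_filter.2
        ⟨Finset.mem_range.2 (by omega), p, q, hpj, hjq, hq, hlt, hpj', hqj'⟩
    have hwf : WellFounded (InvImage (· < ·) fun a : X × X => dist a.1 a.2) :=
      haveI : IsTrans (X × X) (InvImage (· < ·) fun a : X × X => dist a.1 a.2) :=
        ⟨fun _ _ _ => lt_trans (α := ℝ)⟩
      haveI : Std.Irrefl (InvImage (· < ·) fun a : X × X => dist a.1 a.2) :=
        ⟨fun _ => lt_irrefl (α := ℝ) _⟩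
      Finite.wellFounded_of_trans_of_irrefl _
    have hpath : ∀ a : X × X, a.1 ∈ T → a.2 ∈ T → dist a.1 a.2 < 2 * L →
        ∃ ℓ ≤ (1 + 8 * ρ) * dist a.1 a.2,
          EdgePath T (Finset.univ.biUnion E) a.1 a.2 ℓ := fun a => by
      induction a using hwf.induction with
      | _ a ih =>
        obtain ⟨x, y⟩ := a
        intro hx hy hlt
        simp only at hx hy hlt ⊢
        have ih' : ∀ u ∈ T, ∀ v ∈ T, dist u v < dist x y →
            ∃ ℓ ≤ (1 + 8 * ρ) * dist u v, EdgePath T (Finset.univ.biUnion E) u v ℓ :=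
          fun u hu v hv huv => ih (u, v) huv hu hv (lt_trans huv hlt)
        rcases eq_or_ne x y with rfl | hxy
        · exact ⟨0, by simp, .nil hx⟩
        obtain ⟨i, h | h⟩ := hlso x y
        · exact hstep i x hx y hy hxy hlt h ih'
        · beta_reduce at h
          rw [dist_comm x y] at h hlt ih' ⊢
          obtain ⟨ℓ, hℓ, P⟩ := hstep i y hy x hx hxy.symm hlt h ih'
          exact ⟨ℓ, hℓ, P.symm⟩
    intro u hu v hv _ hlt
    obtain ⟨ℓ, hℓ, P⟩ := hpath (u, v) hu hv hlt
    obtain ⟨k, z, h0, hl, hzT, hzE, hs⟩ := P.exists_fin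
    exact ⟨k, z, h0, hl, hzT, hzE, hs.trans_le hℓ⟩
end
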